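/- arXiv:2412.19040 — 7 statements merged into one kernel-verified Lean document; each statement's English description precedes it below -/
import Mathlib

section
/- Let A be a ring and e ∈ A an idempotent such that e·a·(1−e) = 0 for all a ∈ A, and set Ā = A/(AeA). Then for all right Ā-modules X and Y, regarded as right A-modules via the projection A → Ā, and for every i ≥ 0, the canonical map Ext^i_{Ā}(X, Y) → Ext^i_A(X, Y) is an isomorphism (i.e., the restriction functor Mod Ā → Mod A induces a fully faithful functor on bounded derived categories). -/
open CategoryTheory CategoryTheory.Limits

universe w₁ w₂ v₁ v₂ u₁ u₂ u

noncomputable section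

namespace Stmt1

section RestrictScalars

variable {R S : Type u} [Ring R] [Ring S] (g : R →+* S)

instance : (ModuleCat.restrictScalars.{u} g).Additive where
  map_add := rfl

instance : PreservesFiniteLimits (ModuleCat.restrictScalars.{u} g) :=
  ⟨fun _ _ _ => ⟨fun {_} => inferInstance⟩⟩

instance : PreservesFiniteColimits (ModuleCat.restrictScalars.{u} g) :=
  ⟨fun _ _ _ => ⟨fun {_} => inferInstance⟩⟩

end RestrictScalars

section ExtComparison

variable {C₁ : Type u₁} [Category.{v₁} C₁] [Abelian C₁]
  {C₂ : Type u₂} [Category.{v₂} C₂] [Abelian C₂]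
  [HasDerivedCategory.{w₁} C₁] [HasDerivedCategory.{w₂} C₂]
  (F : C₁ ⥤ C₂) [F.Additive] [PreservesFiniteLimits F] [PreservesFiniteColimits F]

/-- For an exact functor `F`, the derived functor `F.mapDerivedCategory` commutes with
the single-complex embeddings. -/
def mapDerivedCategorySingleIso (X : C₁) :
    F.mapDerivedCategory.obj ((DerivedCategory.singleFunctor C₁ 0).obj X) ≅
      (DerivedCategory.singleFunctor C₂ 0).obj (F.obj X) :=
  F.mapDerivedCategoryFactors.app ((CochainComplex.singleFunctor C₁ 0).obj X) ≪≫
    DerivedCategory.Q.mapIso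
      ((HomologicalComplex.singleMapHomologicalComplex F (ComplexShape.up ℤ) 0).app X)

variable [HasExt.{w₁} C₁] [HasExt.{w₂} C₂]

/-- The canonical map `Ext^n_{C₁}(X, Y) → Ext^n_{C₂}(F X, F Y)` induced by an exact
functor `F` between abelian categories. -/
def extComparison {X Y : C₁} {n : ℕ} (α : Abelian.Ext X Y n) :
    Abelian.Ext (F.obj X) (F.obj Y) n :=
  Abelian.Ext.homEquiv.symm
    ((mapDerivedCategorySingleIso F X).inv ≫ F.mapDerivedCategory.map α.hom ≫
      (F.mapDerivedCategory.commShiftIso (n : ℤ)).hom.app _ ≫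
      ((mapDerivedCategorySingleIso F Y).hom)⟦(n : ℤ)⟧')

end ExtComparison

end Stmt1

namespace Stmt1

section General

variable {C₁ : Type u₁} [Category.{v₁} C₁] [Abelian C₁]
  {C₂ : Type u₂} [Category.{v₂} C₂] [Abelian C₂]
  {G : C₂ ⥤ C₁} {F : C₁ ⥤ C₂}

/-- An adjunction between additive functors extends to complexes. -/
def adjComplex [F.Additive] [G.Additive] (adj : G ⊣ F) :
    G.mapHomologicalComplex (ComplexShape.up ℤ) ⊣
      F.mapHomologicalComplex (ComplexShape.up ℤ) :=
  Adjunction.mkOfUnitCounit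
    { unit :=
        { app := fun K =>
            { f := fun i => adj.unit.app (K.X i)
              comm' := fun i j _ => (adj.unit.naturality (K.d i j)).symm }
          naturality := fun K L f => by
            ext i
            exact adj.unit.naturality (f.f i) }
      counit :=
        { app := fun K =>
            { f := fun i => adj.counit.app (K.X i)
              comm' := fun i j _ => (adj.counit.naturality (K.d i j)).symm }
          naturality := fun K L f => by
            ext i
            exact adj.counit.naturality (f.f i) }
      left_triangle := by
        ext K i
        simp
        exact adj.left_triangle_components (K.X i)
      right_triangle := by
        ext K i
        simp
        exact adj.right_triangle_components (K.X i) }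

lemma adjComplex_counit_isIso [F.Additive] [G.Additive] (adj : G ⊣ F) [IsIso adj.counit]
    (K : CochainComplex C₁ ℤ) : IsIso ((adjComplex adj).counit.app K) := by
  have : ∀ i, IsIso (((adjComplex adj).counit.app K).f i) := fun i => by
    change IsIso (adj.counit.app (K.X i))
    infer_instance
  exact HomologicalComplex.Hom.isIso_of_components _

variable [HasDerivedCategory.{w₁} C₁] [HasDerivedCategory.{w₂} C₂]
  [F.Additive] [PreservesFiniteLimits F] [PreservesFiniteColimits F]
  [G.Additive] [PreservesFiniteLimits G] [PreservesFiniteColimits G]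

instance : CatCommSq (F.mapHomologicalComplex (ComplexShape.up ℤ)) DerivedCategory.Q
    DerivedCategory.Q F.mapDerivedCategory := ⟨F.mapDerivedCategoryFactors.symm⟩

/-- The adjunction on derived categories. -/
def adjDerived (adj : G ⊣ F) : G.mapDerivedCategory ⊣ F.mapDerivedCategory :=
  (adjComplex adj).localization
    DerivedCategory.Q (HomologicalComplex.quasiIso C₂ (ComplexShape.up ℤ))
    DerivedCategory.Q (HomologicalComplex.quasiIso C₁ (ComplexShape.up ℤ))
    G.mapDerivedCategory F.mapDerivedCategory

lemma adjDerived_counit_isIso (adj : G ⊣ F) [IsIso adj.counit] :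
    IsIso (adjDerived adj).counit := by
  have : ∀ X, IsIso ((adjDerived adj).counit.app X) := fun X => by
    have hQ : ∀ K : CochainComplex C₁ ℤ,
        IsIso ((adjDerived adj).counit.app (DerivedCategory.Q.obj K)) := fun K => by
      have := adjComplex_counit_isIso adj K
      rw [adjDerived, Adjunction.localization_counit_app]
      infer_instance
    have := Localization.essSurj (DerivedCategory.Q (C := C₁))
      (HomologicalComplex.quasiIso C₁ (ComplexShape.up ℤ))
    have h1 := hQ ((DerivedCategory.Q (C := C₁)).objPreimage X)
    exact (NatTrans.isIso_app_iff_of_iso (adjDerived adj).counit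
      ((DerivedCategory.Q (C := C₁)).objObjPreimageIso X)).1 h1
  exact NatIso.isIso_of_isIso_app _

lemma extComparison_bijective [HasExt.{w₁} C₁] [HasExt.{w₂} C₂] (adj : G ⊣ F)
    [IsIso adj.counit] (X Y : C₁) (n : ℕ) :
    Function.Bijective (extComparison F (X := X) (Y := Y) (n := n)) := by
  have := adjDerived_counit_isIso adj
  have hF := (adjDerived adj).fullyFaithfulROfIsIsoCounit
  let e := (mapDerivedCategorySingleIso F X).homCongr
    ((F.mapDerivedCategory.commShiftIso (n : ℤ)).app _ ≪≫
      (shiftFunctor (DerivedCategory C₂) (n : ℤ)).mapIso (mapDerivedCategorySingleIso F Y))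
  have key : (extComparison F (X := X) (Y := Y) (n := n)) =
      Abelian.Ext.homEquiv.symm ∘ e ∘ hF.homEquiv ∘ Abelian.Ext.homEquiv := by
    funext α
    simp only [extComparison, Function.comp_apply, e, Iso.homCongr_apply]
    rfl
  rw [key]
  exact Abelian.Ext.homEquiv.symm.bijective.comp
    (e.bijective.comp (hF.homEquiv.bijective.comp Abelian.Ext.homEquiv.bijective))

end General

section Concrete

variable {R S : Type u} [Ring R] [Ring S] (g : R →+* S) (e : R)

/-- The submodule `eM`, under the hypothesis `re = ere`. -/
def eSub (he : ∀ r : R, e * (r * e) = r * e) (M : Type u) [AddCommGroup M] [Module R M] :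
    Submodule R M where
  carrier := {m | e • m = m}
  zero_mem' := smul_zero _
  add_mem' := fun {a b} ha hb => by
    simp only [Set.mem_ofPred_eq] at *
    rw [smul_add, ha, hb]
  smul_mem' := fun r m hm => by
    simp only [Set.mem_ofPred_eq] at *
    rw [← hm, smul_smul, smul_smul, smul_smul, mul_assoc, he]

variable {e} (he : ∀ r : R, e * (r * e) = r * e)

lemma mem_eSub {M : Type u} [AddCommGroup M] [Module R M] (m : M) :
    m ∈ eSub e he M ↔ e • m = m := Iff.rfl

variable {g} (hg : Function.Surjective g) (hk : ∀ r, g r = 0 → e * r = r)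

/-- `M / eM` as an `S`-module. -/
@[reducible] def quotModule (M : Type u) [AddCommGroup M] [Module R M] :
    Module S (M ⧸ eSub e he M) :=
  letI : SMul S (M ⧸ eSub e he M) := ⟨fun s x => Function.surjInv hg s • x⟩
  Function.Surjective.moduleLeft g hg (by
    intro r x
    change Function.surjInv hg (g r) • x = r • x
    induction x using Submodule.Quotient.induction_on with
    | H m =>
      rw [← Submodule.Quotient.mk_smul, ← Submodule.Quotient.mk_smul, Submodule.Quotient.eq,
        ← sub_smul, mem_eSub, smul_smul, hk]
      rw [map_sub, Function.surjInv_eq hg, sub_self])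

lemma quotModule_smul (M : Type u) [AddCommGroup M] [Module R M] (r : R) (x : M ⧸ eSub e he M) :
    letI := quotModule he hg hk M
    (g r • x : M ⧸ eSub e he M) = r • x := by
  change Function.surjInv hg (g r) • x = r • x
  induction x using Submodule.Quotient.induction_on with
  | H m =>
    rw [← Submodule.Quotient.mk_smul, ← Submodule.Quotient.mk_smul, Submodule.Quotient.eq,
      ← sub_smul, mem_eSub, smul_smul, hk]
    rw [map_sub, Function.surjInv_eq hg, sub_self]

/-- `M / eM` as an object. -/
def Lobj (M : ModuleCat.{u} R) : ModuleCat.{u} S :=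
  letI := quotModule he hg hk M
  ModuleCat.of S (M ⧸ eSub e he M)

/-- The projection. -/
def Lpi (M : ModuleCat.{u} R) :
    M ⟶ (ModuleCat.restrictScalars g).obj (Lobj he hg hk M) :=
  ModuleCat.ofHom (Y := (ModuleCat.restrictScalars g).obj (Lobj he hg hk M))
    { toFun := fun m => (Submodule.Quotient.mk m : M ⧸ eSub e he M)
      map_add' := fun _ _ => rfl
      map_smul' := fun r m => (quotModule_smul he hg hk M r (Submodule.Quotient.mk m)).symm }

lemma Lpi_surj (M : ModuleCat.{u} R) : Function.Surjective (Lpi he hg hk M).hom :=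
  fun x => Submodule.Quotient.mk_surjective _ x

lemma Lpi_eq_zero (M : ModuleCat.{u} R) (m : M) :
    (Lpi he hg hk M).hom m = 0 ↔ e • m = m :=
  Submodule.Quotient.mk_eq_zero (eSub e he M)

variable (hge : g e = 0)

/-- Descend a map. -/
def Ldesc {M : ModuleCat.{u} R} {N : ModuleCat.{u} S}
    (f : M ⟶ (ModuleCat.restrictScalars g).obj N) : Lobj he hg hk M ⟶ N :=
  letI := quotModule he hg hk M
  let φ : M →+ N := AddMonoidHom.mk' (fun m => (f.hom m : N)) (fun a b => f.hom.map_add a b)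
  have hφ : ∀ m ∈ (eSub e he M).toAddSubgroup, φ m = 0 := fun m hm => by
    have h1 : f.hom (e • m) = f.hom m := congrArg _ hm
    rw [f.hom.map_smul] at h1
    have h2 : (g e • (f.hom m : N) : N) = f.hom m := h1
    rw [hge, zero_smul] at h2
    exact h2.symm
  ModuleCat.ofHom (X := M ⧸ eSub e he M) (Y := N)
    { toFun := QuotientAddGroup.lift (eSub e he M).toAddSubgroup φ hφ
      map_add' := fun a b => map_add _ a b
      map_smul' := fun s x => by
        obtain ⟨r, rfl⟩ := hg s
        rw [quotModule_smul]
        induction x using Submodule.Quotient.induction_on with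
        | H m => exact f.hom.map_smul r m }

lemma Ldesc_pi {M : ModuleCat.{u} R} {N : ModuleCat.{u} S}
    (f : M ⟶ (ModuleCat.restrictScalars g).obj N) :
    Lpi he hg hk M ≫ (ModuleCat.restrictScalars g).map (Ldesc he hg hk hge f) = f := by
  ext m
  rfl

lemma Lhom_ext {M : ModuleCat.{u} R} {N : ModuleCat.{u} S} {a b : Lobj he hg hk M ⟶ N}
    (h : Lpi he hg hk M ≫ (ModuleCat.restrictScalars g).map a =
      Lpi he hg hk M ≫ (ModuleCat.restrictScalars g).map b) : a = b := by
  ext x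
  obtain ⟨m, rfl⟩ := Lpi_surj he hg hk M x
  exact ConcreteCategory.congr_hom h m

/-- Hom equivalence. -/
def Lequiv (M : ModuleCat.{u} R) (N : ModuleCat.{u} S) :
    (Lobj he hg hk M ⟶ N) ≃ (M ⟶ (ModuleCat.restrictScalars g).obj N) where
  toFun a := Lpi he hg hk M ≫ (ModuleCat.restrictScalars g).map a
  invFun f := Ldesc he hg hk hge f
  left_inv a := Lhom_ext he hg hk (Ldesc_pi he hg hk hge _)
  right_inv f := Ldesc_pi he hg hk hge f

/-- The left adjoint functor. -/
def L : ModuleCat.{u} R ⥤ ModuleCat.{u} S :=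
  Adjunction.leftAdjointOfEquiv (G := ModuleCat.restrictScalars g)
    (F_obj := Lobj he hg hk) (Lequiv he hg hk hge)
    (fun X Y Y' a b => by
      simp [Lequiv])

/-- The adjunction. -/
def Ladj : L he hg hk hge ⊣ ModuleCat.restrictScalars.{u} g :=
  Adjunction.adjunctionOfEquivLeft (G := ModuleCat.restrictScalars g)
    (F_obj := Lobj he hg hk) (Lequiv he hg hk hge)
    (fun X Y Y' a b => by
      simp [Lequiv])

lemma L_map_pi {M N : ModuleCat.{u} R} (f : M ⟶ N) :
    Lpi he hg hk M ≫ (ModuleCat.restrictScalars g).map ((L he hg hk hge).map f) =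
      f ≫ Lpi he hg hk N := by
  have : (L he hg hk hge).map f = Ldesc he hg hk hge (f ≫ Lpi he hg hk N) := by
    simp [L, Lequiv]
  rw [this]
  exact Ldesc_pi he hg hk hge _

lemma L_mono {M N : ModuleCat.{u} R} (f : M ⟶ N) [Mono f] : Mono ((L he hg hk hge).map f) := by
  rw [ModuleCat.mono_iff_injective]
  have hf := (ModuleCat.mono_iff_injective f).1 inferInstance
  refine (injective_iff_map_eq_zero ((L he hg hk hge).map f).hom).2 fun x hx => ?_
  obtain ⟨m, rfl⟩ := Lpi_surj he hg hk M x
  have h1 : (Lpi he hg hk N).hom (f.hom m) = 0 :=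
    (ConcreteCategory.congr_hom (L_map_pi he hg hk hge f) m).symm.trans hx
  rw [Lpi_eq_zero, ← f.hom.map_smul] at h1
  exact (Lpi_eq_zero he hg hk M m).2 (hf h1)

instance : PreservesColimitsOfSize.{0, 0} (L he hg hk hge) :=
  (Ladj he hg hk hge).leftAdjoint_preservesColimits

instance : PreservesFiniteColimits (L he hg hk hge) :=
  PreservesColimitsOfSize.preservesFiniteColimits _

instance : (L he hg hk hge).Additive :=
  (Ladj he hg hk hge).left_adjoint_additive

instance : (L he hg hk hge).PreservesMonomorphisms := ⟨fun f _ => L_mono he hg hk hge f⟩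

instance : PreservesFiniteLimits (L he hg hk hge) := by
  have := Functor.preservesHomology_of_preservesMonos_and_cokernels (L he hg hk hge)
  exact Functor.preservesFiniteLimits_of_preservesHomology _

lemma restrict_full (hg : Function.Surjective g) : (ModuleCat.restrictScalars.{u} g).Full where
  map_surjective {X Y} f := ⟨ModuleCat.ofHom
    { toFun := fun x => (f.hom x : Y)
      map_add' := fun a b => f.hom.map_add a b
      map_smul' := fun s x => by
        obtain ⟨r, rfl⟩ := hg s
        exact f.hom.map_smul r x }, rfl⟩

lemma concrete_bijective [HasDerivedCategory.{w₁} (ModuleCat.{u} R)]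
    [HasDerivedCategory.{w₂} (ModuleCat.{u} S)]
    [HasExt.{w₁} (ModuleCat.{u} R)] [HasExt.{w₂} (ModuleCat.{u} S)]
    (he : ∀ r : R, e * (r * e) = r * e)
    (hg : Function.Surjective g) (hk : ∀ r, g r = 0 → e * r = r) (hge : g e = 0)
    (X Y : ModuleCat.{u} S) (n : ℕ) :
    Function.Bijective
      (extComparison (ModuleCat.restrictScalars.{u} g) (X := X) (Y := Y) (n := n)) := by
  have := restrict_full hg
  exact extComparison_bijective (Ladj he hg hk hge) X Y n

end Concrete

end Stmt1

section

attribute [local instance] HasDerivedCategory.standard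
attribute [local instance] CategoryTheory.hasExt_of_hasDerivedCategory

set_option synthInstance.maxHeartbeats 1000000 in
set_option maxHeartbeats 2000000 in
/--
Let `A` be a ring and `e ∈ A` an idempotent such that `e·a·(1−e) = 0` for all `a ∈ A`,
and set `Ā = A/(AeA)`.  Then for all right `Ā`-modules `X` and `Y`, regarded as right
`A`-modules via the projection `A → Ā`, and for every `i ≥ 0`, the canonical map
`Ext^i_{Ā}(X, Y) → Ext^i_A(X, Y)` is an isomorphism (i.e. the restriction functor
`Mod Ā → Mod A` induces a fully faithful functor on bounded derived categories).
-/
theorem stmt1 {A : Type u} [Ring A] (e : A) (he : IsIdempotentElem e)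
    (h : ∀ a : A, e * a * (1 - e) = 0)
    (X Y : ModuleCat.{u} ((TwoSidedIdeal.span {e}).ringCon.Quotient)ᵐᵒᵖ) (i : ℕ) :
    Function.Bijective
      (Stmt1.extComparison
        (ModuleCat.restrictScalars.{u}
          (RingHom.op ((TwoSidedIdeal.span ({e} : Set A)).ringCon.mk')))
        (X := X) (Y := Y) (n := i)) := by
  have hmem : ∀ a ∈ TwoSidedIdeal.span ({e} : Set A), a * e = a := by
    intro a ha
    induction ha using TwoSidedIdeal.span_induction with
    | mem x hx =>
      rw [Set.mem_singleton_iff.1 hx]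
      exact he
    | zero => exact zero_mul _
    | add x y _ _ hx hy => rw [add_mul, hx, hy]
    | neg x _ hx => rw [neg_mul, hx]
    | left_absorb a x _ hx => rw [mul_assoc, hx]
    | right_absorb b x _ hx =>
      have h1 := h b
      rw [mul_sub, mul_one, sub_eq_zero] at h1
      calc x * b * e = x * e * b * e := by rw [hx]
        _ = x * (e * b * e) := by simp only [mul_assoc]
        _ = x * b := by rw [← h1, ← mul_assoc, hx]
  refine Stmt1.concrete_bijective (e := MulOpposite.op e) ?_ ?_ ?_ ?_ X Y i
  · intro r
    have h1 := h r.unop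
    rw [mul_sub, mul_one, sub_eq_zero] at h1
    exact MulOpposite.unop_injective h1.symm
  · intro s
    obtain ⟨a, ha⟩ := (TwoSidedIdeal.span ({e} : Set A)).ringCon.mk'_surjective s.unop
    exact ⟨MulOpposite.op a, MulOpposite.unop_injective ha⟩
  · intro r hr
    have h1 : (TwoSidedIdeal.span ({e} : Set A)).ringCon.mk' r.unop = 0 :=
      congrArg MulOpposite.unop hr
    refine MulOpposite.unop_injective (hmem r.unop ?_)
    rw [← TwoSidedIdeal.ker_ringCon_mk' (TwoSidedIdeal.span ({e} : Set A))]
    exact h1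
  · refine MulOpposite.unop_injective ?_
    have h1 : e ∈ TwoSidedIdeal.span ({e} : Set A) := TwoSidedIdeal.subset_span rfl
    rw [← TwoSidedIdeal.ker_ringCon_mk' (TwoSidedIdeal.span ({e} : Set A))] at h1
    exact h1

end

end
end

section
/- Let k be a field, A a finite-dimensional k-algebra, and e ∈ A an idempotent such that e·a·(1−e) = 0 for all a ∈ A and such that the subalgebra eAe is a semisimple ring. Then for every finitely generated right A-module X, the subset X·e of X is a right A-submodule, it equals X·(AeA), and it is isomorphic as a right A-module to a direct summand of (eA)^m for some m ≥ 0 (i.e., X·e·A ∈ add(eA)). -/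
open MulOpposite

/-- The corner ring `eAe` of a ring `A` with respect to an idempotent `e`,
realized as the subtype of elements `x` with `e * x * e = x`. -/
def Corner {A : Type*} [Ring A] (E : {e : A // IsIdempotentElem e}) : Type _ :=
  {x : A // E.1 * x * E.1 = x}

namespace Corner

variable {A : Type*} [Ring A] (E : {e : A // IsIdempotentElem e})

/-- The corner as a non-unital subring. -/
def nonUnitalSubring : NonUnitalSubring A where
  carrier := {x : A | E.1 * x * E.1 = x}
  add_mem' := by
    intro a b ha hb
    simp only [Set.mem_setOf_eq] at *
    rw [mul_add, add_mul, ha, hb]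
  zero_mem' := by simp
  neg_mem' := by
    intro a ha
    simp only [Set.mem_setOf_eq] at *
    rw [mul_neg, neg_mul, ha]
  mul_mem' := by
    intro a b ha hb
    simp only [Set.mem_setOf_eq] at *
    have ha1 : E.1 * a = a := by
      rw [← ha, ← mul_assoc E.1 (E.1 * a) E.1, ← mul_assoc E.1 E.1 a, E.2.eq]
    have hb2 : b * E.1 = b := by rw [← hb, mul_assoc (E.1 * b) E.1 E.1, E.2.eq]
    rw [← mul_assoc, ha1, mul_assoc, hb2]

instance : NonUnitalRing (Corner E) :=
  inferInstanceAs (NonUnitalRing (nonUnitalSubring E))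

instance : Ring (Corner E) :=
  { (inferInstance : NonUnitalRing (Corner E)) with
    one := ⟨E.1, by rw [E.2.eq, E.2.eq]⟩
    one_mul := fun x => Subtype.ext
      (show E.1 * x.1 = x.1 by
        rw [← x.2, ← mul_assoc E.1 (E.1 * x.1) E.1, ← mul_assoc E.1 E.1 x.1, E.2.eq])
    mul_one := fun x => Subtype.ext
      (show x.1 * E.1 = x.1 by rw [← x.2, mul_assoc (E.1 * x.1) E.1 E.1, E.2.eq]) }

end Corner

/-- The ring homomorphism `A → eAe`, `a ↦ e a`, on opposite rings. -/
def Corner.proj {A : Type*} [Ring A] (e : A) (he : IsIdempotentElem e)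
    (hh : ∀ a : A, e * a * e = e * a) : Aᵐᵒᵖ →+* (Corner ⟨e, he⟩)ᵐᵒᵖ where
  toFun a := op ⟨e * a.unop, by
    show e * (e * a.unop) * e = e * a.unop
    rw [← mul_assoc, he.eq, hh]⟩
  map_one' := by
    apply unop_injective
    apply Subtype.ext
    show e * 1 = e
    rw [mul_one]
  map_mul' a b := by
    apply unop_injective
    apply Subtype.ext
    show e * (b.unop * a.unop) = (e * b.unop) * (e * a.unop)
    rw [← mul_assoc (e * b.unop), hh, mul_assoc]
  map_zero' := by
    apply unop_injective
    apply Subtype.ext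
    show e * 0 = 0
    rw [mul_zero]
  map_add' a b := by
    apply unop_injective
    apply Subtype.ext
    show e * (a.unop + b.unop) = e * a.unop + e * b.unop
    rw [mul_add]

theorem mem_eA {A : Type*} [Ring A] (e : A) (he : IsIdempotentElem e)
    (hh : ∀ a : A, e * a * e = e * a) (x : A) :
    x ∈ Submodule.span Aᵐᵒᵖ ({e} : Set A) ↔ e * x * e = x := by
  rw [Submodule.mem_span_singleton]
  constructor
  · rintro ⟨a, rfl⟩
    show e * (e * a.unop) * e = e * a.unop
    rw [← mul_assoc, he.eq, hh]
  · intro hx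
    refine ⟨op x, ?_⟩
    show e * x = x
    rw [← hh, hx]

theorem eA_semisimple {A : Type*} [Ring A] (e : A) (he : IsIdempotentElem e)
    (hh : ∀ a : A, e * a * e = e * a) (hss : IsSemisimpleRing (Corner ⟨e, he⟩)) :
    IsSemisimpleModule Aᵐᵒᵖ (Submodule.span Aᵐᵒᵖ ({e} : Set A)) := by
  have hex : ∀ x : A, e * x * e = x → e * x = x := fun x hx => by rw [← hh, hx]
  have hxe : ∀ x : A, e * x * e = x → x * e = x := fun x hx => by
    rw [← hx, mul_assoc (e * x), he.eq]
  haveI : RingHomSurjective (Corner.proj e he hh) := ⟨fun y => by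
    refine ⟨op y.unop.1, ?_⟩
    apply unop_injective
    apply Subtype.ext
    exact hex _ y.unop.2⟩
  let f : Submodule.span Aᵐᵒᵖ ({e} : Set A) →ₛₗ[Corner.proj e he hh] (Corner ⟨e, he⟩)ᵐᵒᵖ :=
    { toFun := fun x => op ⟨x.1, (mem_eA e he hh _).1 x.2⟩
      map_add' := fun x y => rfl
      map_smul' := fun a x => by
        apply unop_injective
        apply Subtype.ext
        show x.1 * a.unop = x.1 * (e * a.unop)
        rw [← mul_assoc, hxe _ ((mem_eA e he hh _).1 x.2)] }
  have hf : Function.Bijective f := by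
    constructor
    · intro x y hxy
      apply Subtype.ext
      exact congrArg (fun z => z.unop.1) hxy
    · intro y
      exact ⟨⟨y.unop.1, (mem_eA e he hh _).2 y.unop.2⟩, rfl⟩
  exact (LinearMap.isSemisimpleModule_iff_of_bijective f hf).2 inferInstance

/--
Let `k` be a field, `A` a finite-dimensional `k`-algebra, and `e ∈ A` an idempotent such
that `e·a·(1−e) = 0` for all `a ∈ A` and such that the corner ring `eAe` is semisimple.
Then for every finitely generated right `A`-module `X`:
* the subset `X·e ⊆ X` is a right `A`-submodule;
* it equals `X·(AeA)` (the submodule generated by the elements `x·(a·e·b)`);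
* and it is isomorphic, as a right `A`-module, to a direct summand of `(eA)^m` for some
  `m ≥ 0`, i.e. `X·e·A ∈ add (eA)`.
-/
theorem stmt2 {k A : Type*} [Field k] [Ring A] [Algebra k A] [FiniteDimensional k A]
    (e : A) (he : IsIdempotentElem e) (h : ∀ a : A, e * a * (1 - e) = 0)
    (hss : IsSemisimpleRing (Corner ⟨e, he⟩))
    (X : Type*) [AddCommGroup X] [Module Aᵐᵒᵖ X] [Module.Finite Aᵐᵒᵖ X] :
    (∃ N : Submodule Aᵐᵒᵖ X, (N : Set X) = {y : X | ∃ x : X, y = op e • x}) ∧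
    (Submodule.span Aᵐᵒᵖ {y : X | ∃ x : X, y = op e • x} =
      Submodule.span Aᵐᵒᵖ {y : X | ∃ (x : X) (a b : A), y = op (a * e * b) • x}) ∧
    (∃ (m : ℕ)
      (ι : ↥(Submodule.span Aᵐᵒᵖ {y : X | ∃ x : X, y = op e • x}) →ₗ[Aᵐᵒᵖ]
            (Fin m → ↥(Submodule.span Aᵐᵒᵖ ({e} : Set A))))
      (π : (Fin m → ↥(Submodule.span Aᵐᵒᵖ ({e} : Set A))) →ₗ[Aᵐᵒᵖ]
            ↥(Submodule.span Aᵐᵒᵖ {y : X | ∃ x : X, y = op e • x})),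
      π.comp ι = LinearMap.id) := by
  have hh : ∀ a : A, e * a * e = e * a := fun a => by
    have := h a
    rw [mul_sub, mul_one, sub_eq_zero] at this
    exact this.symm
  have hee : ∀ x : X, op e • op e • x = op e • x := fun x => by
    rw [smul_smul, ← op_mul, he.eq]
  let N : Submodule Aᵐᵒᵖ X :=
    { carrier := {y : X | ∃ x : X, y = op e • x}
      add_mem' := by
        rintro _ _ ⟨x, rfl⟩ ⟨y, rfl⟩
        exact ⟨x + y, (smul_add _ _ _).symm⟩
      zero_mem' := ⟨0, (smul_zero _).symm⟩
      smul_mem' := by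
        rintro a _ ⟨x, rfl⟩
        refine ⟨op (e * a.unop) • x, ?_⟩
        rw [smul_smul, smul_smul, ← op_mul, hh, op_mul, op_unop] }
  have hN : (N : Set X) = {y : X | ∃ x : X, y = op e • x} := rfl
  refine ⟨⟨N, hN⟩, ?_, ?_⟩
  · apply le_antisymm
    · apply Submodule.span_mono
      rintro _ ⟨x, rfl⟩
      exact ⟨x, 1, 1, by rw [one_mul, mul_one]⟩
    · rw [Submodule.span_le]
      rintro _ ⟨x, a, b, rfl⟩
      rw [op_mul, op_mul, mul_smul, mul_smul]
      exact Submodule.smul_mem _ _ (Submodule.subset_span ⟨_, rfl⟩)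
  · rw [← hN, Submodule.span_eq]
    haveI := eA_semisimple e he hh hss
    haveI : IsNoetherianRing Aᵐᵒᵖ := isNoetherian_of_tower k inferInstance
    obtain ⟨m, s, hs⟩ := Module.Finite.exists_fin (R := Aᵐᵒᵖ) (M := N)
    let g : N → (Submodule.span Aᵐᵒᵖ ({e} : Set A) →ₗ[Aᵐᵒᵖ] N) := fun n =>
      { toFun := fun a => op a.1 • n
        map_add' := fun a b => by
          show op (a.1 + b.1) • n = _
          rw [op_add, add_smul]
        map_smul' := fun r a => by
          show op (a.1 * r.unop) • n = r • op a.1 • n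
          rw [op_mul, mul_smul, op_unop] }
    let p : (Fin m → Submodule.span Aᵐᵒᵖ ({e} : Set A)) →ₗ[Aᵐᵒᵖ] N :=
      LinearMap.lsum Aᵐᵒᵖ (fun _ => Submodule.span Aᵐᵒᵖ ({e} : Set A)) ℕ (fun i => g (s i))
    have hp : LinearMap.range p = ⊤ := by
      rw [eq_top_iff, ← hs, Submodule.span_le]
      rintro _ ⟨i, rfl⟩
      refine ⟨Pi.single i ⟨e, Submodule.subset_span rfl⟩, ?_⟩
      have h1 : p (Pi.single i ⟨e, Submodule.subset_span rfl⟩) =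
          g (s i) ⟨e, Submodule.subset_span rfl⟩ :=
        LinearMap.lsum_piSingle _ _ _ _ _ _
      rw [h1]
      apply Subtype.ext
      obtain ⟨x, hx⟩ := (s i).2
      show op e • (s i).1 = (s i).1
      rw [hx, hee]
    obtain ⟨j, hj⟩ := IsSemisimpleModule.lifting_property p
      (LinearMap.range_eq_top.1 hp) LinearMap.id
    exact ⟨m, j, p, hj⟩
end

section
/- Let R = ⊕_{i≥0} R_i be a commutative ℕ-graded ring whose degree-0 component R_0 is a semisimple ring, and let c ∈ ℤ. Suppose 0 → X → Y → Z → 0 is a short exact sequence of ℤ-graded R-modules with degree-preserving maps, in which each of X, Y, Z is generated in degree c. For such a module M, let ΩM denote the kernel of the canonical graded R-linear map M_c ⊗_{R_0} R → M, m ⊗ r ↦ r·m. Then the induced sequence 0 → ΩX → ΩY → ΩZ → 0 is exact. -/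
open scoped TensorProduct

theorem aux_decompose {A M N : Type*} [CommRing A] [AddCommGroup M] [Module A M]
    [AddCommGroup N] [Module A N] (P : ℤ → Submodule A M) [DirectSum.Decomposition P]
    (Q : ℤ → Submodule A N) [DirectSum.Decomposition Q] (f : M →ₗ[A] N)
    (hf : ∀ (i : ℤ) (x : M), x ∈ P i → f x ∈ Q i) (c : ℤ) (x : M) :
    (DirectSum.decompose Q (f x) c : N) = f (DirectSum.decompose P x c) := by
  induction x using DirectSum.Decomposition.inductionOn P with
  | zero => simp
  | @homogeneous i m =>
    by_cases h : i = c
    · subst h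
      rw [DirectSum.decompose_of_mem_same Q (hf i m m.2),
        DirectSum.decompose_of_mem_same P m.2]
    · rw [DirectSum.decompose_of_mem_ne Q (hf i m m.2) h,
        DirectSum.decompose_of_mem_ne P m.2 h, map_zero]
  | add a b ha hb => simp [ha, hb]

theorem aux_main {A R X Y Z : Type*} [CommRing A] [CommRing R] [Algebra A R] [Module.Flat A R]
    [AddCommGroup X] [Module R X] [Module A X] [IsScalarTower A R X]
    [AddCommGroup Y] [Module R Y] [Module A Y] [IsScalarTower A R Y]
    [AddCommGroup Z] [Module R Z] [Module A Z] [IsScalarTower A R Z]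
    (P : Submodule A X) (Q : Submodule A Y) (S : Submodule A Z)
    (f : X →ₗ[R] Y) (g : Y →ₗ[R] Z) (f' : P →ₗ[A] Q) (g' : Q →ₗ[A] S)
    (hf : ∀ x, (f' x : Y) = f x) (hg : ∀ x, (g' x : Z) = g x)
    (hinj : Function.Injective f) (hexact : Function.Exact f g)
    (hex : Function.Exact f' g') (hsurj : Function.Surjective g')
    (hgen : Submodule.span R (P : Set X) = ⊤) :
    (∀ u ∈ LinearMap.ker (P.subtype.liftBaseChange R), f'.baseChange R u = 0 → u = 0) ∧
    (∀ v ∈ LinearMap.ker (Q.subtype.liftBaseChange R), g'.baseChange R v = 0 →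
      ∃ u ∈ LinearMap.ker (P.subtype.liftBaseChange R), f'.baseChange R u = v) ∧
    (∀ w ∈ LinearMap.ker (S.subtype.liftBaseChange R),
      ∃ v ∈ LinearMap.ker (Q.subtype.liftBaseChange R), g'.baseChange R v = w) := by
  have hinj' : Function.Injective f' := fun a b h => by
    apply Subtype.ext
    apply hinj
    rw [← hf, ← hf, h]
  have I : Function.Injective (f'.baseChange R) :=
    Module.Flat.lTensor_preserves_injective_linearMap (M := R) f' hinj'
  have E : Function.Exact (f'.baseChange R) (g'.baseChange R) := lTensor_exact R hex hsurj
  have G : Function.Surjective (g'.baseChange R) := LinearMap.lTensor_surjective R hsurj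
  have F1 : ∀ u, Q.subtype.liftBaseChange R (f'.baseChange R u)
      = f (P.subtype.liftBaseChange R u) := fun u => by
    induction u with
    | zero => simp
    | tmul r x => simp [hf]
    | add a b ha hb => simp only [map_add, ha, hb]
  have F2 : ∀ u, S.subtype.liftBaseChange R (g'.baseChange R u)
      = g (Q.subtype.liftBaseChange R u) := fun u => by
    induction u with
    | zero => simp
    | tmul r x => simp [hg]
    | add a b ha hb => simp only [map_add, ha, hb]
  have T : Function.Surjective (P.subtype.liftBaseChange R) := by
    rw [← LinearMap.range_eq_top, LinearMap.range_liftBaseChange, ← hgen]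
    simp
  refine ⟨fun u _ h => I (by rw [h, map_zero]), fun v hv h => ?_, fun w hw => ?_⟩
  · obtain ⟨u, rfl⟩ := (E v).1 h
    refine ⟨u, ?_, rfl⟩
    rw [LinearMap.mem_ker] at hv ⊢
    apply hinj
    rw [← F1, hv, map_zero]
  · obtain ⟨v, rfl⟩ := G w
    rw [LinearMap.mem_ker, F2] at hw
    obtain ⟨x, hx⟩ := (hexact _).1 hw
    obtain ⟨u, rfl⟩ := T x
    refine ⟨v - f'.baseChange R u, ?_, ?_⟩
    · rw [LinearMap.mem_ker, map_sub, F1, hx, sub_self]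
    · rw [map_sub, E.apply_apply_eq_zero, sub_zero]


section

variable {R : Type*} [CommRing R] (𝒜 : ℤ → AddSubgroup R) [GradedRing 𝒜]

/-- The degree zero subring `R₀ = 𝒜 0` of a graded ring acts on `R` by multiplication;
this realizes `R` as an `R₀`-algebra. -/
noncomputable instance grade0Algebra : Algebra (𝒜 0) R :=
  RingHom.toAlgebra
    { toFun := fun x => (x : R)
      map_one' := rfl
      map_mul' := fun _ _ => rfl
      map_zero' := rfl
      map_add' := fun _ _ => rfl }

set_option synthInstance.maxHeartbeats 1000000 in
set_option maxHeartbeats 1000000 in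
/--
Let `R = ⊕_{i ≥ 0} R_i` be a commutative `ℕ`-graded ring (formalized as a `ℤ`-graded ring
with trivial negative components) whose degree-`0` component `R₀ = 𝒜 0` is a semisimple
ring, and let `c ∈ ℤ`.  Suppose `0 → X → Y → Z → 0` is a short exact sequence of
`ℤ`-graded `R`-modules with degree-preserving maps, in which each of `X`, `Y`, `Z` is
generated in degree `c`.  For such a module `M`, `ΩM` denotes the kernel of the canonical
graded `R`-linear map `M_c ⊗_{R₀} R → M`, `m ⊗ r ↦ r·m` (formalized below as
`R ⊗_{R₀} M_c → M`, `r ⊗ m ↦ r • m`).  Then the induced sequence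
`0 → ΩX → ΩY → ΩZ → 0` is exact.
-/
theorem stmt3 (hneg : ∀ i : ℤ, i < 0 → 𝒜 i = ⊥) [IsSemisimpleRing (𝒜 0)] (c : ℤ)
    {X Y Z : Type*}
    [AddCommGroup X] [Module R X] [Module (𝒜 0) X] [IsScalarTower (𝒜 0) R X]
    [AddCommGroup Y] [Module R Y] [Module (𝒜 0) Y] [IsScalarTower (𝒜 0) R Y]
    [AddCommGroup Z] [Module R Z] [Module (𝒜 0) Z] [IsScalarTower (𝒜 0) R Z]
    (ℳX : ℤ → Submodule (𝒜 0) X) [DirectSum.Decomposition ℳX] [SetLike.GradedSMul 𝒜 ℳX]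
    (ℳY : ℤ → Submodule (𝒜 0) Y) [DirectSum.Decomposition ℳY] [SetLike.GradedSMul 𝒜 ℳY]
    (ℳZ : ℤ → Submodule (𝒜 0) Z) [DirectSum.Decomposition ℳZ] [SetLike.GradedSMul 𝒜 ℳZ]
    (f : X →ₗ[R] Y) (g : Y →ₗ[R] Z)
    (hf : ∀ (i : ℤ) (x : X), x ∈ ℳX i → f x ∈ ℳY i)
    (hg : ∀ (i : ℤ) (y : Y), y ∈ ℳY i → g y ∈ ℳZ i)
    (hinj : Function.Injective f) (hsurj : Function.Surjective g)
    (hexact : Function.Exact f g)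
    (hXgen : Submodule.span R (ℳX c : Set X) = ⊤)
    (hYgen : Submodule.span R (ℳY c : Set Y) = ⊤)
    (hZgen : Submodule.span R (ℳZ c : Set Z) = ⊤) :
    (∀ u ∈ LinearMap.ker (((ℳX c).subtype).liftBaseChange R),
      (LinearMap.baseChange R ((f.restrictScalars (𝒜 0)).restrict
        (fun x hx => hf c x hx))) u = 0 → u = 0) ∧
    (∀ v ∈ LinearMap.ker (((ℳY c).subtype).liftBaseChange R),
      (LinearMap.baseChange R ((g.restrictScalars (𝒜 0)).restrict
        (fun y hy => hg c y hy))) v = 0 →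
      ∃ u ∈ LinearMap.ker (((ℳX c).subtype).liftBaseChange R),
        (LinearMap.baseChange R ((f.restrictScalars (𝒜 0)).restrict
          (fun x hx => hf c x hx))) u = v) ∧
    (∀ w ∈ LinearMap.ker (((ℳZ c).subtype).liftBaseChange R),
      ∃ v ∈ LinearMap.ker (((ℳY c).subtype).liftBaseChange R),
        (LinearMap.baseChange R ((g.restrictScalars (𝒜 0)).restrict
          (fun y hy => hg c y hy))) v = w) := by
  have : Module.Projective (𝒜 0) R := Module.projective_of_isSemisimpleRing _ _
  have : Module.Flat (𝒜 0) R := inferInstance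
  refine aux_main (ℳX c) (ℳY c) (ℳZ c) f g _ _ (fun _ => rfl) (fun _ => rfl) hinj hexact
    ?_ ?_ hXgen
  · intro y
    constructor
    · intro h
      have h' : g (y : Y) = 0 := congrArg Subtype.val h
      obtain ⟨x, hx⟩ := (hexact _).1 h'
      refine ⟨DirectSum.decompose ℳX x c, Subtype.ext ?_⟩
      have := aux_decompose ℳX ℳY (f.restrictScalars (𝒜 0)) hf c x
      refine this.symm.trans ?_
      rw [LinearMap.restrictScalars_apply, hx]
      exact DirectSum.decompose_of_mem_same ℳY y.2
    · rintro ⟨x, rfl⟩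
      exact Subtype.ext (hexact.apply_apply_eq_zero (x : X))
  · intro z
    obtain ⟨y, hy⟩ := hsurj z
    refine ⟨DirectSum.decompose ℳY y c, Subtype.ext ?_⟩
    have := aux_decompose ℳY ℳZ (g.restrictScalars (𝒜 0)) hg c y
    refine this.symm.trans ?_
    rw [LinearMap.restrictScalars_apply, hy]
    exact DirectSum.decompose_of_mem_same ℳZ z.2


end
end

section
/- For every v = (v_1, …, v_n) ∈ ℤ^n with m = min_i v_i, the graded R-module M_v is generated in degree −m; that is, M_v equals the R-submodule generated by its degree-(−m) component S_{v − m·1}. -/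
open MvPolynomial

noncomputable section

variable (k : Type*) [Field k] (n : ℕ)

/-- The polynomial ring `S = k[x_1, y_1, …, x_n, y_n]`; the variable `(i, 0)` represents
`x_i` and `(i, 1)` represents `y_i`. -/
abbrev SegreAmbient := MvPolynomial (Fin n × Fin 2) k

/-- The `ℤ^n`-grading: `deg x_i = deg y_i = e_i`, the `i`-th standard basis vector. -/
def segreWeight : Fin n × Fin 2 → (Fin n → ℤ) := fun p => Pi.single p.1 1

/-- The homogeneous component `S_v` of multidegree `v ∈ ℤ^n`. -/
def SegreGrade (v : Fin n → ℤ) : Submodule k (SegreAmbient k n) :=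
  weightedHomogeneousSubmodule k (segreWeight n) v

/-- `M_v = ⊕_{c ∈ ℤ} S_{v + c·1}`, as a `k`-submodule of `S`. -/
def SegreMod (v : Fin n → ℤ) : Submodule k (SegreAmbient k n) where
  carrier := {x | ∀ d ∈ x.support,
    ∃ c : ℤ, (Finsupp.weight (segreWeight n)) d = v + c • (1 : Fin n → ℤ)}
  add_mem' := by
    intro a b ha hb d hd
    rcases Finset.mem_union.mp (MvPolynomial.support_add hd) with h | h
    · exact ha d h
    · exact hb d h
  zero_mem' := by simp
  smul_mem' := by
    intro r x hx d hd
    exact hx d (MvPolynomial.support_smul hd)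

/-- The Segre product `R = ⊕_{c ∈ ℤ} S_{c·1}` (the diagonal Veronese subring of `S`),
as a subalgebra of `S`. -/
def SegreRing : Subalgebra k (SegreAmbient k n) where
  carrier := SegreMod k n 0
  add_mem' := fun ha hb => (SegreMod k n 0).add_mem ha hb
  zero_mem' := (SegreMod k n 0).zero_mem
  one_mem' := by
    intro d hd
    rw [MvPolynomial.mem_support_iff, MvPolynomial.coeff_one] at hd
    have hd0 : d = 0 := by
      by_contra hc
      rw [if_neg (fun h : (0 : Fin n × Fin 2 →₀ ℕ) = d => hc h.symm)] at hd
      exact hd rfl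
    exact ⟨0, by simp [hd0]⟩
  mul_mem' := by
    intro a b ha hb d hd
    obtain ⟨u, hu, v, hv, rfl⟩ := Finset.mem_add.mp (MvPolynomial.support_mul a b hd)
    obtain ⟨c1, hc1⟩ := ha u hu
    obtain ⟨c2, hc2⟩ := hb v hv
    exact ⟨c1 + c2, by rw [map_add, hc1, hc2]; module⟩
  algebraMap_mem' := by
    intro r d hd
    rw [MvPolynomial.mem_support_iff, MvPolynomial.algebraMap_eq, MvPolynomial.coeff_C] at hd
    have hd0 : d = 0 := by
      by_contra hc
      rw [if_neg (fun h : (0 : Fin n × Fin 2 →₀ ℕ) = d => hc h.symm)] at hd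
      exact hd rfl
    exact ⟨0, by simp [hd0]⟩

/-- `M_v` as a module over the Segre product `R`, i.e. as an `R`-submodule of `S`. -/
def SegreRMod (v : Fin n → ℤ) : Submodule (SegreRing k n) (SegreAmbient k n) where
  carrier := SegreMod k n v
  add_mem' := fun ha hb => (SegreMod k n v).add_mem ha hb
  zero_mem' := (SegreMod k n v).zero_mem
  smul_mem' := by
    intro r x hx d hd
    have hd' : d ∈ ((r : SegreAmbient k n) * x).support := hd
    obtain ⟨u, hu, w, hw, rfl⟩ :=
      Finset.mem_add.mp (MvPolynomial.support_mul (r : SegreAmbient k n) x hd')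
    obtain ⟨c1, hc1⟩ := r.2 u hu
    obtain ⟨c2, hc2⟩ := hx w hw
    exact ⟨c1 + c2, by rw [map_add, hc1, hc2]; module⟩

theorem segreWeight_apply (d : Fin n × Fin 2 →₀ ℕ) (i : Fin n) :
    (Finsupp.weight (segreWeight n)) d i = (d (i, 0) : ℤ) + (d (i, 1) : ℤ) := by
  rw [Finsupp.weight_apply, Finsupp.sum_fintype _ _ (by simp), Finset.sum_apply,
    Fintype.sum_prod_type, Finset.sum_eq_single i]
  · simp [segreWeight]
  · intro j _ hj
    simp [segreWeight, Pi.single_apply, hj.symm]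
  · simp

/--
For every `v = (v_1, …, v_n) ∈ ℤ^n` with `m = min_i v_i`, the graded `R`-module `M_v`
is generated in degree `−m`; that is, `M_v` equals the `R`-submodule of `S` generated by
its degree-`(−m)` component `S_{v − m·1}`.
-/
theorem stmt4 (hn : 1 ≤ n) (v : Fin n → ℤ) (m : ℤ)
    (hm : ∀ i, m ≤ v i) (hmin : ∃ i, v i = m) :
    (Submodule.span (SegreRing k n)
        ((SegreGrade k n (v - m • (1 : Fin n → ℤ)) : Set (SegreAmbient k n)))
      : Set (SegreAmbient k n)) = (SegreMod k n v : Set (SegreAmbient k n)) := by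
  apply Set.Subset.antisymm
  · have h : Submodule.span (SegreRing k n)
        ((SegreGrade k n (v - m • (1 : Fin n → ℤ)) : Set (SegreAmbient k n)))
        ≤ SegreRMod k n v := by
      rw [Submodule.span_le]
      intro x hx d hd
      have hx' : IsWeightedHomogeneous (segreWeight n) x (v - m • (1 : Fin n → ℤ)) := hx
      refine ⟨-m, ?_⟩
      rw [hx' (MvPolynomial.mem_support_iff.mp hd)]
      module
    exact h
  · intro x hx
    rw [SetLike.mem_coe, x.as_sum]
    refine Submodule.sum_mem _ fun d hd => ?_
    obtain ⟨c, hc⟩ := hx d hd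
    have hdeg : ∀ i, (d (i, 0) : ℤ) + (d (i, 1) : ℤ) = v i + c := by
      intro i
      rw [← segreWeight_apply, hc]
      simp
    obtain ⟨j, hj⟩ := hmin
    have hcm : 0 ≤ m + c := by
      have := hdeg j
      omega
    let w : Fin n × Fin 2 →₀ ℕ := Finsupp.equivFunOnFinite.symm fun p =>
      if p.2 = 0 then min (d (p.1, 0)) (v p.1 - m).toNat
      else (v p.1 - m).toNat - min (d (p.1, 0)) (v p.1 - m).toNat
    have hw0 : ∀ i, w (i, 0) = min (d (i, 0)) (v i - m).toNat := fun i => by simp [w]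
    have hw1 : ∀ i, w (i, 1) = (v i - m).toNat - min (d (i, 0)) (v i - m).toNat :=
      fun i => by simp [w]
    have hwd : w ≤ d := by
      rintro ⟨i, a⟩
      have h1 := hdeg i
      have h2 := hm i
      fin_cases a
      · have := hw0 i
        simp only [Fin.zero_eta]
        omega
      · have := hw1 i
        simp only [Fin.mk_one]
        omega
    have hww : (Finsupp.weight (segreWeight n)) w = v - m • (1 : Fin n → ℤ) := by
      funext i
      rw [segreWeight_apply, hw0, hw1]
      have := hm i
      simp only [Pi.sub_apply, Pi.smul_apply, Pi.one_apply, smul_eq_mul, mul_one]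
      omega
    have hu : (Finsupp.weight (segreWeight n)) (d - w) = 0 + (m + c) • (1 : Fin n → ℤ) := by
      have h : (Finsupp.weight (segreWeight n)) (d - w) + (Finsupp.weight (segreWeight n)) w
          = v + c • (1 : Fin n → ℤ) := by
        rw [← map_add, tsub_add_cancel_of_le hwd, hc]
      rw [hww] at h
      rw [eq_sub_of_add_eq h]
      module
    have hr : monomial (d - w) (coeff d x) ∈ SegreRing k n := by
      intro e he
      have := MvPolynomial.support_monomial_subset he
      rw [Finset.mem_singleton] at this
      exact ⟨m + c, by rw [this, hu]⟩
    have hprod : monomial d (coeff d x)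
        = (⟨monomial (d - w) (coeff d x), hr⟩ : SegreRing k n) •
          (monomial w 1 : SegreAmbient k n) := by
      change _ = monomial (d - w) (coeff d x) * monomial w 1
      rw [monomial_mul, tsub_add_cancel_of_le hwd, mul_one]
    rw [hprod]
    refine Submodule.smul_mem _ _ (Submodule.subset_span ?_)
    exact isWeightedHomogeneous_monomial _ _ _ hww

end
end

section
/- Let v ∈ {0,1}^n with v ≠ (0,…,0) and v ≠ (1,…,1). Then: (i) (M_v)_c = 0 for all c < 0; (ii) M_v is generated in degree 0, i.e., M_v = R·S_v; and (iii) for every integer t ≤ 0, every R-linear map f : M_v → R satisfying f((M_v)_c) ⊆ R_{c+t} for all c ∈ ℤ is the zero map. -/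
open MvPolynomial

noncomputable section

variable (k : Type*) [Field k] (n : ℕ)

theorem segre_weight_apply (d : Fin n × Fin 2 →₀ ℕ) (i : Fin n) :
    (Finsupp.weight (segreWeight n)) d i = (d (i, 0) : ℤ) + d (i, 1) := by
  rw [Finsupp.weight_apply, Finsupp.sum_fintype _ _ (by simp), Fintype.sum_prod_type]
  simp only [segreWeight, Fin.sum_univ_two, Finset.sum_apply, Pi.add_apply, Pi.smul_apply]
  rw [Finset.sum_eq_single i]
  · simp
  · intro b _ hb
    simp [Pi.single_apply, hb.symm]
  · simp

theorem segre_grade_iff (v : Fin n → ℤ) (x : SegreAmbient k n) :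
    x ∈ SegreGrade k n v ↔ ∀ d ∈ x.support, (Finsupp.weight (segreWeight n)) d = v := by
  simp only [SegreGrade, mem_weightedHomogeneousSubmodule, IsWeightedHomogeneous, mem_support_iff]

theorem segre_grade_mod (v : Fin n → ℤ) (c : ℤ) (x : SegreAmbient k n)
    (hx : x ∈ SegreGrade k n (v + c • (1 : Fin n → ℤ))) : x ∈ SegreMod k n v :=
  fun d hd => ⟨c, (segre_grade_iff k n _ x).1 hx d hd⟩

theorem segre_const (t : ℤ) (ht : t ≤ 0) (x : SegreAmbient k n)
    (hx : x ∈ SegreGrade k n (t • (1 : Fin n → ℤ))) : ∃ a : k, x = C a := by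
  refine ⟨coeff 0 x, ?_⟩
  ext d
  rw [coeff_C]
  split_ifs with h
  · rw [h]
  · by_contra hd
    apply h
    have := (segre_grade_iff k n _ x).1 hx d (mem_support_iff.2 hd)
    ext ⟨i, q⟩
    have h2 := congrFun this i
    rw [segre_weight_apply] at h2
    simp at h2
    fin_cases q <;> simp <;> omega

/-- The monomial `∏ x_i ^ v_i`, with `y_i` in place of `x_i` where `s i = 1`. -/
def segreMon (s : Fin n → Fin 2) (v : Fin n → ℤ) : SegreAmbient k n :=
  ∏ i, X (i, s i) ^ (v i).toNat

theorem segreMon_grade (s : Fin n → Fin 2) (v : Fin n → ℤ) (hv : ∀ i, 0 ≤ v i) :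
    segreMon k n s v ∈ SegreGrade k n v := by
  have h : IsWeightedHomogeneous (segreWeight n) (segreMon k n s v)
      (∑ i, (v i).toNat • segreWeight n (i, s i)) :=
    IsWeightedHomogeneous.prod _ _ _ fun i _ => (isWeightedHomogeneous_X k _ _).pow _
  have e : (∑ i, (v i).toNat • segreWeight n (i, s i)) = v := by
    ext j
    simp only [segreWeight, Finset.sum_apply, Pi.smul_apply]
    rw [Finset.sum_eq_single j]
    · simp [hv j]
    · intro b _ hb
      simp [Pi.single_apply, hb.symm]
    · simp
  rw [e] at h
  exact h

theorem segreMon_ne (s : Fin n → Fin 2) (v : Fin n → ℤ) : segreMon k n s v ≠ 0 :=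
  Finset.prod_ne_zero_iff.2 fun _ _ => pow_ne_zero _ (X_ne_zero _)

theorem segre_mul_mem (a b : SegreAmbient k n) (v w : Fin n → ℤ)
    (ha : a ∈ SegreMod k n v) (hb : b ∈ SegreMod k n w) (h : v + w = 1) :
    a * b ∈ SegreRing k n := by
  intro d hd
  obtain ⟨u, hu, x, hx, rfl⟩ := Finset.mem_add.mp (MvPolynomial.support_mul a b hd)
  obtain ⟨c1, hc1⟩ := ha u hu
  obtain ⟨c2, hc2⟩ := hb x hx
  refine ⟨c1 + c2 + 1, ?_⟩
  rw [map_add, hc1, hc2]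
  have : w = 1 - v := by rw [← h]; abel
  subst this
  module

set_option synthInstance.maxHeartbeats 1000000 in
set_option maxHeartbeats 2000000 in
theorem segre_comm (v : Fin n → ℤ) (hv : ∀ i, v i = 0 ∨ v i = 1)
    (f : ↥(SegreRMod k n v) →ₗ[SegreRing k n] SegreRing k n) (a b : ↥(SegreRMod k n v)) :
    (a : SegreAmbient k n) * (f b : SegreRing k n) = (b : SegreAmbient k n) * (f a : SegreRing k n) := by
  have hz : segreMon k n 0 (1 - v) ∈ SegreMod k n (1 - v) :=
    segre_grade_mod k n _ 0 _ (by
      simpa using segreMon_grade k n 0 (1 - v)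
        (fun i => by rcases hv i with h | h <;> simp [h]))
  have hz0 := segreMon_ne k n 0 (1 - v)
  generalize segreMon k n 0 (1 - v) = z at hz hz0
  let ra : SegreRing k n := ⟨z * a, segre_mul_mem k n _ _ _ _ hz a.2 (by abel)⟩
  let rb : SegreRing k n := ⟨z * b, segre_mul_mem k n _ _ _ _ hz b.2 (by abel)⟩
  have e : ra • b = rb • a := by
    apply Subtype.ext
    change z * (a : SegreAmbient k n) * b = z * (b : SegreAmbient k n) * a
    ring
  have e2 : ra • f b = rb • f a := by rw [← map_smul, ← map_smul, e]
  have e3 : z * (a : SegreAmbient k n) * (f b : SegreRing k n)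
      = z * (b : SegreAmbient k n) * (f a : SegreRing k n) := congrArg Subtype.val e2
  apply mul_left_cancel₀ hz0
  rw [← mul_assoc, ← mul_assoc, e3]

theorem segre_split (v : Fin n → ℤ) (hv : ∀ i, v i = 0 ∨ v i = 1) (c : ℤ) (hc : 0 ≤ c)
    (d : Fin n × Fin 2 →₀ ℕ)
    (hd : (Finsupp.weight (segreWeight n)) d = v + c • (1 : Fin n → ℤ)) :
    ∃ d1 d2 : Fin n × Fin 2 →₀ ℕ, d2 + d1 = d ∧ (Finsupp.weight (segreWeight n)) d1 = v ∧
      (Finsupp.weight (segreWeight n)) d2 = c • (1 : Fin n → ℤ) := by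
  have hw : ∀ i, (d (i, 0) : ℤ) + d (i, 1) = v i + c := fun i => by
    rw [← segre_weight_apply, hd]; simp
  let d1 : Fin n × Fin 2 →₀ ℕ := Finsupp.equivFunOnFinite.symm fun p =>
    if v p.1 = 1 ∧ (p.2 = 0 ↔ 1 ≤ d (p.1, 0)) then 1 else 0
  have a0 : ∀ i, d1 (i, 0) = if v i = 1 ∧ 1 ≤ d (i, 0) then 1 else 0 := by intro i; simp [d1]
  have a1 : ∀ i, d1 (i, 1) = if v i = 1 ∧ ¬ 1 ≤ d (i, 0) then 1 else 0 := by intro i; simp [d1]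
  have h1 : (Finsupp.weight (segreWeight n)) d1 = v := by
    ext i
    rw [segre_weight_apply, a0, a1]
    have := hw i
    rcases hv i with h | h <;> by_cases h' : 1 ≤ d (i, 0) <;> simp [h, h']
  have hle : d1 ≤ d := by
    rintro ⟨i, q⟩
    have := hw i
    have b0 := a0 i
    have b1 := a1 i
    fin_cases q
    · change d1 (i, 0) ≤ d (i, 0)
      split_ifs at b0 <;> omega
    · change d1 (i, 1) ≤ d (i, 1)
      split_ifs at b1 <;> omega
  refine ⟨d1, d - d1, tsub_add_cancel_of_le hle, h1, ?_⟩
  have e : (Finsupp.weight (segreWeight n)) (d - d1 + d1) = v + c • (1 : Fin n → ℤ) := by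
    rw [tsub_add_cancel_of_le hle, hd]
  rw [map_add, h1] at e
  rw [add_comm] at e
  exact add_left_cancel e

set_option synthInstance.maxHeartbeats 1000000 in
set_option maxHeartbeats 2000000 in
/--
Let `v ∈ {0,1}^n` with `v ≠ (0,…,0)` and `v ≠ (1,…,1)`.  Then:
(i) `(M_v)_c = 0` for all `c < 0`;
(ii) `M_v` is generated in degree `0`, i.e. `M_v = R·S_v`; and
(iii) for every integer `t ≤ 0`, every `R`-linear map `f : M_v → R` satisfying
`f((M_v)_c) ⊆ R_{c+t}` for all `c ∈ ℤ` is the zero map.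
-/
theorem stmt5 (hn : 1 ≤ n) (v : Fin n → ℤ)
    (hv : ∀ i, v i = 0 ∨ v i = 1) (hv0 : v ≠ 0) (hv1 : v ≠ 1) :
    (∀ c : ℤ, c < 0 → SegreGrade k n (v + c • (1 : Fin n → ℤ)) = ⊥) ∧
    ((Submodule.span (SegreRing k n) ((SegreGrade k n v : Set (SegreAmbient k n)))
      : Set (SegreAmbient k n)) = (SegreMod k n v : Set (SegreAmbient k n))) ∧
    (∀ t : ℤ, t ≤ 0 →
      ∀ f : ↥(SegreRMod k n v) →ₗ[SegreRing k n] SegreRing k n,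
        (∀ (c : ℤ) (x : ↥(SegreRMod k n v)),
          (x : SegreAmbient k n) ∈ SegreGrade k n (v + c • (1 : Fin n → ℤ)) →
          ((f x : SegreRing k n) : SegreAmbient k n) ∈
            SegreGrade k n ((c + t) • (1 : Fin n → ℤ))) →
        f = 0) := by
  obtain ⟨j, hj⟩ : ∃ j, v j = 1 := by
    by_contra! h
    exact hv0 (funext fun i => (hv i).resolve_right (h i))
  obtain ⟨l, hl⟩ : ∃ l, v l = 0 := by
    by_contra! h
    exact hv1 (funext fun i => (hv i).resolve_left (h i))
  have hnn : ∀ i, 0 ≤ v i := fun i => by rcases hv i with h | h <;> omega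
  have hc0 : ∀ (c : ℤ) (d : Fin n × Fin 2 →₀ ℕ),
      (Finsupp.weight (segreWeight n)) d = v + c • (1 : Fin n → ℤ) → 0 ≤ c := by
    intro c d hd
    have := congrFun hd l
    rw [segre_weight_apply] at this
    simp [hl] at this
    omega
  refine ⟨?_, ?_, ?_⟩
  · intro c hc
    rw [eq_bot_iff]
    intro x hx
    rw [Submodule.mem_bot]
    rw [segre_grade_iff] at hx
    by_contra hne
    obtain ⟨d, hd⟩ := Finset.nonempty_iff_ne_empty.2 (fun h => hne (support_eq_empty.1 h))
    have := hc0 c d (hx d hd)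
    omega
  · apply Set.Subset.antisymm
    · have : Submodule.span (SegreRing k n) ((SegreGrade k n v : Set (SegreAmbient k n)))
          ≤ SegreRMod k n v := by
        rw [Submodule.span_le]
        intro x hx
        exact segre_grade_mod k n v 0 x (by simpa using hx)
      exact this
    · intro x hx
      rw [SetLike.mem_coe, x.as_sum]
      refine Submodule.sum_mem _ fun d hd => ?_
      obtain ⟨c, hc⟩ := hx d hd
      obtain ⟨d1, d2, hdd, h1, h2⟩ := segre_split n v hv c (hc0 c d hc) d hc
      have hr : monomial d2 (coeff d x) ∈ SegreRing k n := by
        intro u hu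
        have := Finset.mem_singleton.1 (support_monomial_subset hu)
        exact ⟨c, by rw [this, h2, zero_add]⟩
      have hm : monomial d1 (1 : k) ∈ SegreGrade k n v := by
        rw [segre_grade_iff]
        intro u hu
        rw [Finset.mem_singleton.1 (support_monomial_subset hu), h1]
      have e : monomial d (coeff d x)
          = (⟨_, hr⟩ : SegreRing k n) • (monomial d1 (1 : k) : SegreAmbient k n) := by
        change _ = monomial d2 (coeff d x) * monomial d1 (1 : k)
        rw [monomial_mul, hdd, mul_one]
      rw [e]
      exact Submodule.smul_mem _ _ (Submodule.subset_span hm)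
  · intro t ht f hf
    have hg : ∀ s, segreMon k n s v ∈ SegreGrade k n (v + (0 : ℤ) • (1 : Fin n → ℤ)) := fun s => by
      simpa using segreMon_grade k n s v hnn
    let m : (Fin n → Fin 2) → ↥(SegreRMod k n v) :=
      fun s => ⟨segreMon k n s v, segre_grade_mod k n v 0 _ (hg s)⟩
    have hm : ∀ s, ∃ a : k, ((f (m s) : SegreRing k n) : SegreAmbient k n) = C a := fun s => by
      have := hf 0 (m s) (hg s)
      rw [zero_add] at this
      exact segre_const k n t ht _ this
    obtain ⟨α, hα⟩ := hm 0
    obtain ⟨β, hβ⟩ := hm (fun _ => 1)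
    have e := segre_comm k n v hv f (m 0) (m (fun _ => 1))
    rw [hα, hβ] at e
    have e2 : segreMon k n 0 v * C β = segreMon k n (fun _ => 1) v * C α := e
    have e3 := congrArg (eval fun p : Fin n × Fin 2 => if p.2 = 0 then (0 : k) else 1) e2
    have z0 : (∏ i, (0 : k) ^ (v i).toNat) = 0 :=
      Finset.prod_eq_zero (Finset.mem_univ j) (by simp [hj])
    simp [segreMon, map_prod, z0] at e3
    have hα0 : α = 0 := by first | exact e3 | exact e3.symm
    apply LinearMap.ext
    intro x
    have h := segre_comm k n v hv f (m 0) x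
    rw [hα, hα0, C_0, mul_zero] at h
    apply Subtype.ext
    exact (mul_eq_zero.1 h).resolve_left (segreMon_ne k n 0 v)

end
end

section
/- Assume d ≥ 2 and let 1 ≤ i ≤ n − 1. Then the map M_{n−i} → Hom_R(M_i, R) sending u to the multiplication map m ↦ u·m (which takes values in R since (cn + (n−i)) + (c'n + i) ≡ 0 mod n) is an isomorphism of R-modules; under this isomorphism the degree-c component of M_{n−i} corresponds to the homogeneous homomorphisms M_i → R of degree c + 1, i.e., the graded dual M_i^* is isomorphic to M_{n−i}(−1) as a graded R-module. -/
open MvPolynomial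

noncomputable section

variable (k : Type*) [Field k] (d n : ℕ)

/-- The standard-graded polynomial ring `S = k[x_1, …, x_d]`. -/
abbrev PolyAmbient := MvPolynomial (Fin d) k

/-- The homogeneous component `S_m` of total degree `m`. -/
def PolyGrade (m : ℕ) : Submodule k (PolyAmbient k d) :=
  homogeneousSubmodule (Fin d) k m

/-- The `n`-th Veronese subring `R = S^{(n)} = ⊕_{c ≥ 0} S_{cn}` as a subalgebra of `S`. -/
def VeroneseRing : Subalgebra k (PolyAmbient k d) where
  carrier := {x | ∀ e ∈ x.support, ∃ c : ℕ, (Finsupp.weight (1 : Fin d → ℕ)) e = c * n}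
  add_mem' := by
    intro a b ha hb e he
    rcases Finset.mem_union.mp (MvPolynomial.support_add he) with h | h
    · exact ha e h
    · exact hb e h
  zero_mem' := by simp
  one_mem' := by
    intro e he
    rw [MvPolynomial.mem_support_iff, MvPolynomial.coeff_one] at he
    have he0 : e = 0 := by
      by_contra hc
      rw [if_neg (fun h : (0 : Fin d →₀ ℕ) = e => hc h.symm)] at he
      exact he rfl
    exact ⟨0, by simp [he0]⟩
  mul_mem' := by
    intro a b ha hb e he
    obtain ⟨u, hu, v, hv, rfl⟩ := Finset.mem_add.mp (MvPolynomial.support_mul a b he)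
    obtain ⟨c1, hc1⟩ := ha u hu
    obtain ⟨c2, hc2⟩ := hb v hv
    exact ⟨c1 + c2, by rw [map_add, hc1, hc2]; ring⟩
  algebraMap_mem' := by
    intro r e he
    rw [MvPolynomial.mem_support_iff, MvPolynomial.algebraMap_eq, MvPolynomial.coeff_C] at he
    have he0 : e = 0 := by
      by_contra hc
      rw [if_neg (fun h : (0 : Fin d →₀ ℕ) = e => hc h.symm)] at he
      exact he rfl
    exact ⟨0, by simp [he0]⟩

/-- The graded `R`-module `M_i = ⊕_c S_{cn+i}`, as an `R`-submodule of `S`. -/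
def VeroneseMod (i : ℕ) : Submodule (VeroneseRing k d n) (PolyAmbient k d) where
  carrier := {x | ∀ e ∈ x.support, ∃ c : ℕ, (Finsupp.weight (1 : Fin d → ℕ)) e = c * n + i}
  add_mem' := by
    intro a b ha hb e he
    rcases Finset.mem_union.mp (MvPolynomial.support_add he) with h | h
    · exact ha e h
    · exact hb e h
  zero_mem' := by simp
  smul_mem' := by
    intro r x hx e he
    have he' : e ∈ ((r : PolyAmbient k d) * x).support := he
    obtain ⟨u, hu, v, hv, rfl⟩ :=
      Finset.mem_add.mp (MvPolynomial.support_mul (r : PolyAmbient k d) x he')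
    obtain ⟨c1, hc1⟩ := r.2 u hu
    obtain ⟨c2, hc2⟩ := hx v hv
    exact ⟨c1 + c2, by rw [map_add, hc1, hc2]; ring⟩

/-- The degree-`c` component `S'_c = ⊕_{j=0}^{n−1} S_{cn+j}` of `S` viewed as a graded
`R`-module over the Veronese subring. -/
def VeroneseSDeg (c : ℤ) : Submodule k (PolyAmbient k d) where
  carrier := {x | ∀ e ∈ x.support, ∃ j : ℕ, j < n ∧
    ((Finsupp.weight (1 : Fin d → ℕ)) e : ℤ) = c * n + j}
  add_mem' := by
    intro a b ha hb e he
    rcases Finset.mem_union.mp (MvPolynomial.support_add he) with h | h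
    · exact ha e h
    · exact hb e h
  zero_mem' := by simp
  smul_mem' := by
    intro r x hx e he
    exact hx e (MvPolynomial.support_smul he)


lemma aux_support {k : Type*} [Field k] {d : ℕ} (a : Fin d) (i : ℕ) (u : MvPolynomial (Fin d) k)
    (e : Fin d →₀ ℕ) (he : coeff e u ≠ 0) : coeff (e + Finsupp.single a i) (u * X a ^ i) ≠ 0 := by
  rw [X_pow_eq_monomial, coeff_mul_monomial, mul_one]
  exact he

lemma aux_weight {d : ℕ} (a : Fin d) (i : ℕ) (e : Fin d →₀ ℕ) :
    Finsupp.weight (1 : Fin d → ℕ) (e + Finsupp.single a i)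
      = Finsupp.weight (1 : Fin d → ℕ) e + i := by
  rw [map_add, Finsupp.weight_single]; simp

lemma aux_X_mem {k : Type*} [Field k] {d n : ℕ} (a : Fin d) (i : ℕ) :
    (X a ^ i : PolyAmbient k d) ∈ VeroneseMod k d n i := by
  intro e he
  rw [X_pow_eq_monomial] at he
  have := Finset.mem_singleton.mp (support_monomial_subset he)
  subst this
  refine ⟨0, ?_⟩
  rw [Finsupp.weight_single]; simp

lemma aux_mul_mem {k : Type*} [Field k] {d n i : ℕ} (hi : i ≤ n) {u m : PolyAmbient k d}
    (hu : u ∈ VeroneseMod k d n (n - i)) (hm : m ∈ VeroneseMod k d n i) :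
    u * m ∈ VeroneseRing k d n := by
  intro e he
  obtain ⟨a, ha, b, hb, rfl⟩ := Finset.mem_add.mp (MvPolynomial.support_mul u m he)
  obtain ⟨c1, hc1⟩ := hu a ha
  obtain ⟨c2, hc2⟩ := hm b hb
  refine ⟨c1 + c2 + 1, ?_⟩
  rw [map_add, hc1, hc2]
  have : n - i + i = n := by omega
  linear_combination this

set_option synthInstance.maxHeartbeats 1000000 in
set_option maxHeartbeats 2000000 in
lemma aux_comm {k : Type*} [Field k] {d n i : ℕ} (hd : 2 ≤ d) (hi : i ≤ n)
    (f : ↥(VeroneseMod k d n i) →ₗ[VeroneseRing k d n] VeroneseRing k d n)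
    (m m' : ↥(VeroneseMod k d n i)) :
    (m' : PolyAmbient k d) * (f m : PolyAmbient k d) = (m : PolyAmbient k d) * (f m' : PolyAmbient k d) := by
  let t : PolyAmbient k d := X (⟨0, by omega⟩ : Fin d) ^ (n - i)
  have ht : t ∈ VeroneseMod k d n (n - i) := aux_X_mem _ _
  have ht0 : t ≠ 0 := pow_ne_zero _ (X_ne_zero _)
  let r : VeroneseRing k d n := ⟨t * m, aux_mul_mem hi ht m.2⟩
  let r' : VeroneseRing k d n := ⟨t * m', aux_mul_mem hi ht m'.2⟩
  have h : r' • m = r • m' := by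
    apply Subtype.ext
    change t * (m' : PolyAmbient k d) * (m : PolyAmbient k d) = t * m * m'
    ring
  have h2 := congrArg f h
  rw [map_smul, map_smul] at h2
  have h3 : t * (m' : PolyAmbient k d) * (f m : PolyAmbient k d) = t * m * (f m' : PolyAmbient k d) :=
    congrArg Subtype.val h2
  apply mul_left_cancel₀ ht0
  rw [← mul_assoc, h3, mul_assoc]

set_option synthInstance.maxHeartbeats 1000000 in
set_option maxHeartbeats 2000000 in
lemma aux_surj {k : Type*} [Field k] {d n i : ℕ} (hd : 2 ≤ d) (hi1 : 1 ≤ i) (hi : i ≤ n)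
    (f : ↥(VeroneseMod k d n i) →ₗ[VeroneseRing k d n] VeroneseRing k d n) :
    ∃ u ∈ VeroneseMod k d n (n - i), ∀ m : ↥(VeroneseMod k d n i),
      (f m : PolyAmbient k d) = u * m := by
  let a : Fin d := ⟨0, by omega⟩
  let b : Fin d := ⟨1, by omega⟩
  have hab : a ≠ b := by simp [a, b]
  let p : ↥(VeroneseMod k d n i) := ⟨X a ^ i, aux_X_mem a i⟩
  let q : ↥(VeroneseMod k d n i) := ⟨X b ^ i, aux_X_mem b i⟩
  have hpq : (X b ^ i : PolyAmbient k d) * (f p : PolyAmbient k d) = X a ^ i * (f q : PolyAmbient k d) :=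
    aux_comm hd hi f p q
  have hp : Prime (X a : PolyAmbient k d) := X_prime
  have hdvd : (X a ^ i : PolyAmbient k d) ∣ f p := by
    refine hp.pow_dvd_of_dvd_mul_left i (a := X b ^ i) (fun h => ?_) ⟨_, hpq⟩
    have := hp.dvd_of_dvd_pow h
    rw [X_dvd_X] at this
    exact hab (by simpa using this)
  obtain ⟨u, hu⟩ := hdvd
  refine ⟨u, ?_, fun m => ?_⟩
  · intro e he
    have h1 := aux_support a i u e (mem_support_iff.mp he)
    rw [mul_comm, ← hu] at h1
    obtain ⟨c, hc⟩ := (f p).2 _ (mem_support_iff.mpr h1)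
    rw [aux_weight] at hc
    obtain _ | c := c
    · omega
    · refine ⟨c, ?_⟩
      rw [add_mul] at hc
      omega
  · have h := aux_comm hd hi f m p
    change X a ^ i * (f m : PolyAmbient k d) = (m : PolyAmbient k d) * (f p : PolyAmbient k d) at h
    rw [hu] at h
    apply mul_left_cancel₀ (pow_ne_zero i (X_ne_zero a) : (X a ^ i : PolyAmbient k d) ≠ 0)
    rw [h]; ring

set_option synthInstance.maxHeartbeats 1000000 in
set_option maxHeartbeats 2000000 in
/-- The multiplication map. -/
def auxMul {k : Type*} [Field k] {d n i : ℕ} (hi : i ≤ n) :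
    ↥(VeroneseMod k d n (n - i)) →ₗ[VeroneseRing k d n]
        (↥(VeroneseMod k d n i) →ₗ[VeroneseRing k d n] VeroneseRing k d n) where
  toFun u :=
    { toFun := fun m => ⟨u * m, aux_mul_mem hi u.2 m.2⟩
      map_add' := fun x y => Subtype.ext (mul_add (u : PolyAmbient k d) x y)
      map_smul' := fun r x => Subtype.ext
        (mul_left_comm (u : PolyAmbient k d) (r : PolyAmbient k d) x) }
  map_add' u v := LinearMap.ext fun m => Subtype.ext (add_mul (u : PolyAmbient k d) v m)
  map_smul' r u := LinearMap.ext fun m => Subtype.ext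
    (mul_assoc (r : PolyAmbient k d) (u : PolyAmbient k d) m)

set_option synthInstance.maxHeartbeats 1000000 in
set_option maxHeartbeats 2000000 in
/--
Assume `d ≥ 2` and let `1 ≤ i ≤ n − 1`.  Then the map `M_{n−i} → Hom_R(M_i, R)` sending
`u` to the multiplication map `m ↦ u·m` is an isomorphism of `R`-modules; under this
isomorphism the degree-`c` component of `M_{n−i}` corresponds to the homogeneous
homomorphisms `M_i → R` of degree `c + 1`, i.e. the graded dual `M_i^*` is isomorphic to
`M_{n−i}(−1)` as a graded `R`-module.
-/
theorem stmt8 (hd : 2 ≤ d) (hn : 2 ≤ n) (i : ℕ) (hi1 : 1 ≤ i) (hi : i ≤ n - 1) :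
    ∃ Φ : ↥(VeroneseMod k d n (n - i)) ≃ₗ[VeroneseRing k d n]
        (↥(VeroneseMod k d n i) →ₗ[VeroneseRing k d n] VeroneseRing k d n),
      (∀ (u : ↥(VeroneseMod k d n (n - i))) (m : ↥(VeroneseMod k d n i)),
        ((Φ u m : VeroneseRing k d n) : PolyAmbient k d) =
          (u : PolyAmbient k d) * (m : PolyAmbient k d)) ∧
      (∀ (c : ℕ) (u : ↥(VeroneseMod k d n (n - i))),
        (u : PolyAmbient k d) ∈ PolyGrade k d (c * n + (n - i)) →
        ∀ (c' : ℕ) (m : ↥(VeroneseMod k d n i)),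
          (m : PolyAmbient k d) ∈ PolyGrade k d (c' * n + i) →
          ((Φ u m : VeroneseRing k d n) : PolyAmbient k d) ∈
            PolyGrade k d ((c + c' + 1) * n)) ∧
      (∀ (f : ↥(VeroneseMod k d n i) →ₗ[VeroneseRing k d n] VeroneseRing k d n) (c : ℕ),
        (∀ (c' : ℕ) (m : ↥(VeroneseMod k d n i)),
          (m : PolyAmbient k d) ∈ PolyGrade k d (c' * n + i) →
          ((f m : VeroneseRing k d n) : PolyAmbient k d) ∈
            PolyGrade k d ((c' + c + 1) * n)) →
        ∃ u : ↥(VeroneseMod k d n (n - i)),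
          (u : PolyAmbient k d) ∈ PolyGrade k d (c * n + (n - i)) ∧ Φ u = f) := by
  have hin : i ≤ n := by omega
  let a : Fin d := ⟨0, by omega⟩
  have hX : (X a ^ i : PolyAmbient k d) ≠ 0 := pow_ne_zero i (X_ne_zero a)
  have hbij : Function.Bijective (auxMul (k := k) (d := d) hin) := by
    constructor
    · intro u v huv
      have h := congrArg Subtype.val (LinearMap.congr_fun huv ⟨X a ^ i, aux_X_mem a i⟩)
      have h' : (u : PolyAmbient k d) * X a ^ i = (v : PolyAmbient k d) * X a ^ i := h
      exact Subtype.ext (mul_right_cancel₀ hX h')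
    · intro f
      obtain ⟨u, hu, h⟩ := aux_surj hd hi1 hin f
      exact ⟨⟨u, hu⟩, LinearMap.ext fun m => Subtype.ext (h m).symm⟩
  refine ⟨LinearEquiv.ofBijective (auxMul hin) hbij, fun u m => rfl, ?_, ?_⟩
  · intro c u hu c' m hm
    have h : IsHomogeneous ((u : PolyAmbient k d) * (m : PolyAmbient k d)) (c * n + (n - i) + (c' * n + i)) :=
      IsHomogeneous.mul hu hm
    have e : c * n + (n - i) + (c' * n + i) = (c + c' + 1) * n := by
      have : n - i + i = n := by omega
      linear_combination this
    rw [e] at h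
    exact h
  · intro f c hf
    obtain ⟨u, rfl⟩ := hbij.2 f
    refine ⟨u, ?_, rfl⟩
    have h := hf 0 ⟨X a ^ i, aux_X_mem a i⟩ (by
      have := (isHomogeneous_X k a).pow i
      rw [one_mul] at this
      rw [zero_mul, zero_add]
      exact this)
    intro e he
    have h1 := aux_support a i (u : PolyAmbient k d) e he
    have h2 : Finsupp.weight (1 : Fin d → ℕ) (e + Finsupp.single a i) = (0 + c + 1) * n := h h1
    rw [aux_weight, zero_add, add_mul] at h2
    omega

end
end

section
/- Let a ≥ 1, n ≥ 2 and d = an. Let p ≥ 0 and t ∈ ℤ with t ≠ p. Then every R-linear map f : S → N_p that is homogeneous of degree t, i.e., satisfies f(S'_c) ⊆ (N_p)_{c+t} for all c ∈ ℤ, factors through a finitely generated free R-module: there exist a finitely generated free R-module F and R-linear maps g : S → F and h : F → N_p with f = h ∘ g. (In other words, the graded stable Hom-module sHom_R(S, Ω^p S) is concentrated in degree p.) -/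
open MvPolynomial

noncomputable section

variable (k : Type*) [Field k] (d n : ℕ)

open scoped TensorProduct

set_option synthInstance.maxHeartbeats 1000000 in
set_option maxHeartbeats 2000000 in
/-- The canonical evaluation map `R ⊗_k W → N`, `r ⊗ m ↦ r • m`, for a `k`-subspace `W`
of a module `N` over the Veronese subring `R` (this formalizes the canonical map
`(N_p)_p ⊗_k R → N`, `m ⊗ r ↦ m·r`). -/
def epsilonMap {N : Type*} [AddCommGroup N] [Module (VeroneseRing k d n) N]
    [Module k N] [IsScalarTower k (VeroneseRing k d n) N] (W : Submodule k N) :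
    (VeroneseRing k d n) ⊗[k] ↥W →ₗ[VeroneseRing k d n] N :=
  (W.subtype).liftBaseChange (VeroneseRing k d n)

set_option synthInstance.maxHeartbeats 1000000 in
set_option maxHeartbeats 2000000 in
/-- The degree-`c` component of `R ⊗_k W`, where `W` is placed in degree `p` and
`R_q ⊗ W` sits in degree `p + q`:  it is spanned by the elementary tensors `r ⊗ m` with
`r ∈ R_{c−p} = S_{(c−p)n}`. -/
def tensorGrade {N : Type*} [AddCommGroup N] [Module (VeroneseRing k d n) N]
    [Module k N] [IsScalarTower k (VeroneseRing k d n) N]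
    (W : Submodule k N) (p : ℕ) (c : ℤ) :
    Submodule k ((VeroneseRing k d n) ⊗[k] ↥W) :=
  if (p : ℤ) ≤ c then
    Submodule.span k {z | ∃ (r : VeroneseRing k d n) (m : ↥W),
      (r : PolyAmbient k d) ∈ PolyGrade k d ((c - p).toNat * n) ∧ z = r ⊗ₜ[k] m}
  else ⊥



/-- Index type of the Koszul complex on `r` elements. -/
def KIx : ℕ → Type
  | 0 => Unit
  | r + 1 => KIx r ⊕ KIx r

theorem KIx_finite : ∀ r, Finite (KIx r)
  | 0 => inferInstanceAs (Finite Unit)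
  | r + 1 => by
    have := KIx_finite r
    exact inferInstanceAs (Finite (KIx r ⊕ KIx r))

/-- The bottom index. -/
def KIx.bot : ∀ r, KIx r
  | 0 => ()
  | r + 1 => Sum.inl (KIx.bot r)

/-- The Koszul differential. -/
def kd {A F : Type*} [CommRing A] [AddCommGroup F] [Module A F] (x : ℕ → A) :
    ∀ r, (KIx r → F) → (KIx r → F)
  | 0, _ => fun _ => 0
  | r + 1, z => Sum.elim
      (fun i => kd x r (fun j => z (Sum.inl j)) i + x r • z (Sum.inr i))
      (fun i => - kd x r (fun j => z (Sum.inr j)) i)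

section kos
variable {A F G : Type*} [CommRing A] [AddCommGroup F] [Module A F] [AddCommGroup G] [Module A G]
  (x : ℕ → A)

theorem kd_inl (r : ℕ) (z : KIx (r + 1) → F) (i : KIx r) :
    kd x (r + 1) z (Sum.inl i) = kd x r (fun j => z (Sum.inl j)) i + x r • z (Sum.inr i) := rfl

theorem kd_inr (r : ℕ) (z : KIx (r + 1) → F) (i : KIx r) :
    kd x (r + 1) z (Sum.inr i) = - kd x r (fun j => z (Sum.inr j)) i := rfl

theorem kd_map (φ : F →ₗ[A] G) : ∀ (r : ℕ) (z : KIx r → F) (i : KIx r),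
    kd x r (fun j => φ (z j)) i = φ (kd x r z i)
  | 0, z, i => by simp [kd]
  | r + 1, z, Sum.inl i => by
    rw [kd_inl, kd_inl, kd_map φ r, map_add, map_smul]
  | r + 1, z, Sum.inr i => by
    rw [kd_inr, kd_inr, kd_map φ r, map_neg]

theorem kd_sub : ∀ (r : ℕ) (z w : KIx r → F) (i : KIx r),
    kd x r (fun j => z j - w j) i = kd x r z i - kd x r w i
  | 0, z, w, i => by simp [kd]
  | r + 1, z, w, Sum.inl i => by
    rw [kd_inl, kd_inl, kd_inl, kd_sub r, smul_sub]; abel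
  | r + 1, z, w, Sum.inr i => by
    rw [kd_inr, kd_inr, kd_inr, kd_sub r]; abel

theorem kd_add : ∀ (r : ℕ) (z w : KIx r → F) (i : KIx r),
    kd x r (fun j => z j + w j) i = kd x r z i + kd x r w i
  | 0, z, w, i => by simp [kd]
  | r + 1, z, w, Sum.inl i => by
    rw [kd_inl, kd_inl, kd_inl, kd_add r, smul_add]; abel
  | r + 1, z, w, Sum.inr i => by
    rw [kd_inr, kd_inr, kd_inr, kd_add r]; abel

theorem kd_smul (s : A) (r : ℕ) (z : KIx r → F) (i : KIx r) :
    kd x r (fun j => s • z j) i = s • kd x r z i :=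
  kd_map x (LinearMap.lsmul A F s) r z i

theorem kd_neg (r : ℕ) (z : KIx r → F) (i : KIx r) :
    kd x r (fun j => - z j) i = - kd x r z i :=
  kd_map x (- LinearMap.id) r z i

theorem kd_kd : ∀ (r : ℕ) (z : KIx r → F) (i : KIx r), kd x r (kd x r z) i = 0
  | 0, z, i => rfl
  | r + 1, z, Sum.inl i => by
    rw [kd_inl, kd_inr]
    simp only [kd_inl]
    rw [kd_add, kd_smul, kd_kd r]
    simp
  | r + 1, z, Sum.inr i => by
    rw [kd_inr]
    simp only [kd_inr]
    rw [kd_neg, kd_kd r]; simp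

theorem kd_mem (T : AddSubgroup F) : ∀ (r : ℕ) (z : KIx r → F),
    (∀ a < r, ∀ i, x a • z i ∈ T) → ∀ i, kd x r z i ∈ T
  | 0, z, _, i => T.zero_mem
  | r + 1, z, h, Sum.inl i => by
    rw [kd_inl]
    exact T.add_mem (kd_mem T r _ (fun a ha i => h a (by omega) _) i) (h r (by omega) _)
  | r + 1, z, h, Sum.inr i => by
    rw [kd_inr]
    exact T.neg_mem (kd_mem T r _ (fun a ha i => h a (by omega) _) i)

/-- Element concentrated in exterior degree zero. -/
def kdelta (u : F) : ∀ r, KIx r → F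
  | 0 => fun _ => u
  | r + 1 => Sum.elim (kdelta u r) (fun _ => 0)

theorem kdelta_inl (u : F) (r : ℕ) (i : KIx r) :
    kdelta u (r + 1) (Sum.inl i) = kdelta u r i := rfl

theorem kdelta_inr (u : F) (r : ℕ) (i : KIx r) :
    kdelta u (r + 1) (Sum.inr i) = 0 := rfl

theorem kdelta_bot (u : F) : ∀ r, kdelta u r (KIx.bot r) = u
  | 0 => rfl
  | r + 1 => kdelta_bot u r

theorem kdelta_add (u v : F) : ∀ r i, kdelta (u + v) r i = kdelta u r i + kdelta v r i
  | 0, _ => rfl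
  | r + 1, Sum.inl i => kdelta_add u v r i
  | r + 1, Sum.inr i => by simp [kdelta_inr]

theorem kdelta_zero : ∀ r i, kdelta (0 : F) r i = 0
  | 0, _ => rfl
  | r + 1, Sum.inl i => kdelta_zero r i
  | r + 1, Sum.inr i => by simp [kdelta_inr]

theorem kdelta_smul (s : A) (u : F) : ∀ r i, kdelta (s • u) r i = s • kdelta u r i
  | 0, _ => rfl
  | r + 1, Sum.inl i => kdelta_smul s u r i
  | r + 1, Sum.inr i => by simp [kdelta_inr]

theorem kdelta_mem (T : AddSubgroup F) (u : F) (hu : u ∈ T) : ∀ r i, kdelta u r i ∈ T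
  | 0, _ => hu
  | r + 1, Sum.inl i => kdelta_mem T u hu r i
  | r + 1, Sum.inr i => T.zero_mem

theorem kd_zero (r : ℕ) (i : KIx r) : kd x r (fun _ => (0 : F)) i = 0 :=
  kd_map x (0 : F →ₗ[A] F) r (fun _ => 0) i

theorem kd_kdelta (u : F) : ∀ r i, kd x r (kdelta u r) i = 0
  | 0, _ => rfl
  | r + 1, Sum.inl i => by
    rw [kd_inl]
    simp only [kdelta_inl, kdelta_inr, smul_zero, add_zero]
    exact kd_kdelta u r i
  | r + 1, Sum.inr i => by
    rw [kd_inr]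
    simp only [kdelta_inr]
    rw [kd_zero, neg_zero]

end kos

/-- Polynomials all of whose monomials have degree in `D`. -/
def SDset (D : Set ℕ) : Submodule k (PolyAmbient k d) where
  carrier := {s | ∀ e ∈ s.support, (Finsupp.weight (1 : Fin d → ℕ)) e ∈ D}
  add_mem' := by
    intro a b ha hb e he
    rcases Finset.mem_union.mp (MvPolynomial.support_add he) with h | h
    · exact ha e h
    · exact hb e h
  zero_mem' := by simp
  smul_mem' := by
    intro r x hx e he
    exact hx e (MvPolynomial.support_smul he)

/-- The variables as a sequence. -/
def xseq (r : ℕ) : PolyAmbient k d := if h : r < d then X ⟨r, h⟩ else 0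

section poly
variable {k d}

theorem mem_SDset {D : Set ℕ} {s : PolyAmbient k d} :
    s ∈ SDset k d D ↔ ∀ e, coeff e s ≠ 0 → (Finsupp.weight (1 : Fin d → ℕ)) e ∈ D := by
  simp [SDset, MvPolynomial.mem_support_iff]

theorem SDset_mono {D D' : Set ℕ} (h : D ⊆ D') {s : PolyAmbient k d} (hs : s ∈ SDset k d D) :
    s ∈ SDset k d D' := fun e he => h (hs e he)

theorem SDset_mul {D D' D'' : Set ℕ} (h : ∀ a ∈ D, ∀ b ∈ D', a + b ∈ D'') {s t : PolyAmbient k d}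
    (hs : s ∈ SDset k d D) (ht : t ∈ SDset k d D') : s * t ∈ SDset k d D'' := by
  intro e he
  obtain ⟨u, hu, v, hv, rfl⟩ := Finset.mem_add.mp (MvPolynomial.support_mul s t he)
  rw [map_add]
  exact h _ (hs u hu) _ (ht v hv)

theorem wt_single (a : Fin d) (i : ℕ) :
    Finsupp.weight (1 : Fin d → ℕ) (Finsupp.single a i) = i := by
  simp [Finsupp.weight_apply]

theorem monomial_mem_SDset (e : Fin d →₀ ℕ) (c : k) {D : Set ℕ}
    (h : Finsupp.weight (1 : Fin d → ℕ) e ∈ D) : monomial e c ∈ SDset k d D := by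
  intro e' he'
  have := MvPolynomial.support_monomial_subset he'
  rw [Finset.mem_singleton] at this
  rwa [this]

theorem X_mem_SDset (a : Fin d) : (X a : PolyAmbient k d) ∈ SDset k d {1} :=
  monomial_mem_SDset _ _ (wt_single a 1)

theorem Xpow_mem_SDset (a : Fin d) (i : ℕ) : (X a ^ i : PolyAmbient k d) ∈ SDset k d {i} := by
  rw [X_pow_eq_monomial]
  exact monomial_mem_SDset _ _ (wt_single a i)

theorem xseq_mem_SDset (a : ℕ) : xseq k d a ∈ SDset k d {1} := by
  unfold xseq
  split_ifs
  · exact X_mem_SDset _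
  · exact Submodule.zero_mem _

theorem koszul_step (D : Set ℕ) : ∀ r (hr : r ≤ d) (z : KIx r → PolyAmbient k d),
    (∀ i, z i ∈ SDset k d ((· + 1) '' D)) → (∀ i, kd (xseq k d) r z i = 0) →
    ∃ y : KIx r → PolyAmbient k d, ∃ u : PolyAmbient k d, (∀ i, y i ∈ SDset k d D) ∧
      u ∈ SDset k d ((· + 1) '' D) ∧
      (∀ e, coeff e u ≠ 0 → ∀ a : Fin d, (a : ℕ) < r → e a = 0) ∧
      ∀ i, z i = kd (xseq k d) r y i + kdelta u r i
  | 0, hr, z, hz, hc => by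
    refine ⟨fun _ => 0, z (), fun _ => Submodule.zero_mem _, hz _, fun e _ a ha => by omega, ?_⟩
    intro i
    simp [kd, kdelta]
    rfl
  | r + 1, hr, z, hz, hc => by
    have hxr : xseq k d r = X (⟨r, by omega⟩ : Fin d) := dif_pos (by omega)
    set b : Fin d := ⟨r, by omega⟩ with hb
    obtain ⟨v', v0, hv', hv0, hv0', hv⟩ := koszul_step D r (by omega) (fun j => z (Sum.inr j))
      (fun i => hz _) (fun i => by
        have := hc (Sum.inr i)
        rw [kd_inr] at this
        exact neg_eq_zero.mp this)
    have hz1 : ∀ i, kd (xseq k d) r (fun j => z (Sum.inl j) + xseq k d r • v' j) i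
        + xseq k d r • kdelta v0 r i = 0 := by
      intro i
      have := hc (Sum.inl i)
      rw [kd_inl, hv i] at this
      rw [kd_add, kd_smul, ← this, smul_add]; abel
    have hv00 : v0 = 0 := by
      by_contra hne
      obtain ⟨e, he⟩ := MvPolynomial.ne_zero_iff.mp hne
      have h1 := hz1 (KIx.bot r)
      rw [kdelta_bot] at h1
      let T : AddSubgroup (PolyAmbient k d) :=
        { carrier := {s | ∀ e, (∀ a : Fin d, (a : ℕ) < r → e a = 0) → coeff e s = 0}
          add_mem' := fun ha hb e he => by rw [coeff_add, ha e he, hb e he, add_zero]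
          zero_mem' := fun e he => by simp
          neg_mem' := fun ha e he => by rw [coeff_neg, ha e he, neg_zero] }
      have h2 : kd (xseq k d) r (fun j => z (Sum.inl j) + xseq k d r • v' j) (KIx.bot r) ∈ T := by
        apply kd_mem
        intro a ha i e he
        have hxa : xseq k d a = X (⟨a, by omega⟩ : Fin d) := dif_pos (by omega)
        rw [hxa, smul_eq_mul, coeff_X_mul', if_neg]
        rw [Finsupp.mem_support_iff, not_not]
        exact he _ ha
      have h3 := h2 (Finsupp.single b 1 + e) (by
        intro a ha
        have hab : b ≠ a := by
          intro h; rw [← h, hb] at ha; simp at ha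
        rw [Finsupp.add_apply, Finsupp.single_apply, if_neg hab, hv0' e he a ha])
      have h4 := congrArg (coeff (Finsupp.single b 1 + e)) h1
      rw [coeff_add, h3, zero_add, hxr, smul_eq_mul, coeff_X_mul] at h4
      exact he (by simpa using h4)
    subst hv00
    have hDX : ∀ s ∈ SDset k d D, xseq k d r • s ∈ SDset k d ((· + 1) '' D) := by
      intro s hs
      rw [smul_eq_mul]
      refine SDset_mul ?_ (xseq_mem_SDset r) hs
      rintro a rfl m hm
      exact ⟨m, hm, by simp; omega⟩
    obtain ⟨y, u0, hy, hu0, hu0', hyu⟩ := koszul_step D r (by omega)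
      (fun j => z (Sum.inl j) + xseq k d r • v' j)
      (fun i => Submodule.add_mem _ (hz _) (hDX _ (hv' i))) (fun i => by
        have := hz1 i
        rwa [kdelta_zero, smul_zero, add_zero] at this)
    let u1 : PolyAmbient k d := u0.divMonomial (Finsupp.single b 1)
    let u2 : PolyAmbient k d := u0.modMonomial (Finsupp.single b 1)
    have hu12 : xseq k d r • u1 + u2 = u0 := by
      rw [hxr, smul_eq_mul]; exact divMonomial_add_modMonomial_single _ _
    have hu1 : u1 ∈ SDset k d D := by
      rw [mem_SDset]
      intro e he
      have : coeff (Finsupp.single b 1 + e) u0 ≠ 0 := by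
        rwa [← coeff_divMonomial]
      obtain ⟨m, hm, hm'⟩ := mem_SDset.mp hu0 _ this
      rw [map_add, wt_single] at hm'
      have : Finsupp.weight (1 : Fin d → ℕ) e = m := by simp at hm'; omega
      rwa [this]
    have hu2 : ∀ e, coeff e u2 ≠ 0 → coeff e u0 ≠ 0 ∧ e b = 0 := by
      intro e he
      by_cases h : Finsupp.single b 1 ≤ e
      · exact absurd (coeff_modMonomial_of_le _ h) he
      · refine ⟨?_, ?_⟩
        · rwa [← coeff_modMonomial_of_not_le _ h]
        · by_contra hne
          exact h (by rw [Finsupp.single_le_iff]; omega)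
    refine ⟨Sum.elim y (fun i => kdelta u1 r i - v' i), u2, ?_, ?_, ?_, ?_⟩
    · rintro (i | i)
      · exact hy i
      · exact Submodule.sub_mem _ (kdelta_mem (SDset k d D).toAddSubgroup u1 hu1 r i) (hv' i)
    · rw [mem_SDset]
      intro e he
      exact mem_SDset.mp hu0 e (hu2 e he).1
    · intro e he a ha
      rcases Nat.lt_succ_iff_lt_or_eq.mp ha with h | h
      · exact hu0' e (hu2 e he).1 a h
      · have : a = b := Fin.ext h
        rw [this]; exact (hu2 e he).2
    · rintro (i | i)
      · show z (Sum.inl i) = (kd (xseq k d) r y i + xseq k d r • (kdelta u1 r i - v' i))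
          + kdelta u2 r i
        have h1 := hyu i
        have h2 : kdelta u0 r i = xseq k d r • kdelta u1 r i + kdelta u2 r i := by
          rw [← hu12, kdelta_add, kdelta_smul]
        rw [h2] at h1
        rw [smul_sub]
        rw [← sub_eq_zero] at h1 ⊢
        rw [← h1]
        abel
      · show z (Sum.inr i) = - kd (xseq k d) r (fun j => kdelta u1 r j - v' j) i + 0
        have h3 := hv i
        rw [kdelta_zero] at h3
        rw [kd_sub, h3]
        have h5 := kd_kdelta (xseq k d) u1 r i
        change kd (xseq k d) r (fun j => kdelta u1 r j) i = 0 at h5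
        rw [h5]
        change kd (xseq k d) r (fun j => v' j) i + _ = _
        abel

theorem koszul_exact (D : Set ℕ) (z : KIx d → PolyAmbient k d)
    (hz : ∀ i, z i ∈ SDset k d ((· + 1) '' D)) (hc : ∀ i, kd (xseq k d) d z i = 0) :
    ∃ y : KIx d → PolyAmbient k d, (∀ i, y i ∈ SDset k d D) ∧
      (∀ i, z i = kd (xseq k d) d y i) := by
  obtain ⟨y, u, hy, hu, hu', h⟩ := koszul_step D d le_rfl z hz hc
  have hu0 : u = 0 := by
    by_contra hne
    obtain ⟨e, he⟩ := MvPolynomial.ne_zero_iff.mp hne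
    have he0 : e = 0 := Finsupp.ext fun a => hu' e he a a.2
    obtain ⟨m, _, hm⟩ := mem_SDset.mp hu e he
    rw [he0] at hm
    simp at hm
  refine ⟨y, hy, fun i => ?_⟩
  rw [h i, hu0, kdelta_zero, add_zero]

/-- The version for free modules. -/
theorem koszul_exact_free {β : Type*} (D : Set ℕ) (z : KIx d → (β →₀ PolyAmbient k d))
    (hz : ∀ i b, z i b ∈ SDset k d ((· + 1) '' D)) (hc : ∀ i, kd (xseq k d) d z i = 0) :
    ∃ y : KIx d → (β →₀ PolyAmbient k d), (∀ i b, y i b ∈ SDset k d D) ∧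
      (∀ i, z i = kd (xseq k d) d y i) := by
  classical
  have key : ∀ b : β, ∃ y : KIx d → PolyAmbient k d, (∀ i, y i ∈ SDset k d D) ∧
      (∀ i, z i b = kd (xseq k d) d y i) ∧ ((∀ i, z i b = 0) → ∀ i, y i = 0) := by
    intro b
    by_cases h0 : ∀ i, z i b = 0
    · refine ⟨fun _ => 0, fun _ => Submodule.zero_mem _, fun i => ?_, fun _ _ => rfl⟩
      rw [kd_zero, h0]
    · obtain ⟨y, hy, hy'⟩ := koszul_exact D (fun i => z i b) (fun i => hz i b) (fun i => by
        have := kd_map (xseq k d) (Finsupp.lapply b : (β →₀ PolyAmbient k d) →ₗ[PolyAmbient k d] _)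
          d z i
        rw [hc i, map_zero] at this
        exact this)
      exact ⟨y, hy, hy', fun h => absurd h h0⟩
  choose y hy hy' hy0 using key
  have := KIx_finite d
  have := Fintype.ofFinite (KIx d)
  let Y : KIx d → (β →₀ PolyAmbient k d) := fun i =>
    Finsupp.onFinset (Finset.univ.biUnion fun j => (z j).support) (fun b => y b i) (by
      intro b hb
      by_contra hne
      apply hb
      apply hy0
      intro j
      by_contra hj
      exact hne (Finset.mem_biUnion.mpr ⟨j, Finset.mem_univ _, Finsupp.mem_support_iff.mpr hj⟩))
  refine ⟨Y, fun i b => hy b i, fun i => Finsupp.ext fun b => ?_⟩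
  rw [hy' b i]
  exact kd_map (xseq k d) (Finsupp.lapply b : (β →₀ PolyAmbient k d) →ₗ[PolyAmbient k d] _) d Y i

end poly

section poly2
variable {k d}

theorem mem_PolyGrade {m : ℕ} {s : PolyAmbient k d} :
    s ∈ PolyGrade k d m ↔ s ∈ SDset k d {m} := by
  rw [mem_SDset]
  rfl

theorem poly_dvd_of_eq {a b : Fin d} (hab : a ≠ b) (i : ℕ) (s t : PolyAmbient k d)
    (h : X a ^ i * s = X b ^ i * t) : X b ^ i * s.divMonomial (Finsupp.single b i) = s := by
  have hp : Prime (X b : PolyAmbient k d) := MvPolynomial.X_prime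
  have hnd : ¬ (X b : PolyAmbient k d) ∣ X a ^ i := by
    intro hd
    have := hp.dvd_of_dvd_pow hd
    rw [MvPolynomial.X_dvd_X] at this
    exact hab this.symm
  obtain ⟨u, hu⟩ : (X b : PolyAmbient k d) ^ i ∣ s :=
    hp.pow_dvd_of_dvd_mul_left i hnd ⟨t, h⟩
  rw [hu, X_pow_eq_monomial, divMonomial_monomial_mul]

theorem div_mem_SDset {D D' : Set ℕ} (b : Fin d) (i : ℕ) (s : PolyAmbient k d)
    (hs : s ∈ SDset k d D) (hD : ∀ m, i + m ∈ D → m ∈ D') :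
    s.divMonomial (Finsupp.single b i) ∈ SDset k d D' := by
  rw [mem_SDset]
  intro e he
  rw [coeff_divMonomial] at he
  have := mem_SDset.mp hs _ he
  rw [map_add, wt_single] at this
  exact hD _ this

theorem dvd_of_eq_free {β : Type*} {a b : Fin d} (hab : a ≠ b) (i : ℕ)
    (s t : β →₀ PolyAmbient k d)
    (h : (X a ^ i : PolyAmbient k d) • s = (X b ^ i : PolyAmbient k d) • t) :
    (X b ^ i : PolyAmbient k d) • (s.mapRange
      (fun p => p.divMonomial (Finsupp.single b i)) (by simp)) = s := by
  ext1 j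
  rw [Finsupp.smul_apply, Finsupp.mapRange_apply, smul_eq_mul]
  refine poly_dvd_of_eq hab i _ (t j) ?_
  have := DFunLike.congr_fun h j
  simpa using this

end poly2

/-- A concrete model of the `q`-th syzygy module together with the extension to `S`. -/
structure SyzModel {N : Type*} [AddCommGroup N] [Module (VeroneseRing k d n) N]
    [Module k N] (G : ℤ → Submodule k N) (q : ℕ) (β : Type*) where
  emb : N →ₗ[VeroneseRing k d n] (β →₀ PolyAmbient k d)
  deg : ℕ → Submodule k (β →₀ PolyAmbient k d)
  inj : Function.Injective emb
  fwd : ∀ (c : ℕ) (x : N), x ∈ G (q + c) → emb x ∈ deg (c * n)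
  bwd : ∀ (c : ℕ) y, y ∈ deg (c * n) → ∃ x ∈ G (q + c), emb x = y
  neg : ∀ (c : ℤ) (x : N), c < q → x ∈ G c → x = 0
  step : ∀ (l a : ℕ) y, y ∈ deg l → xseq k d a • y ∈ deg (l + 1)
  exact : ∀ (l : ℕ) (z : KIx d → (β →₀ PolyAmbient k d)), (∀ i, z i ∈ deg (l + 1)) →
    (∀ i, kd (xseq k d) d z i = 0) →
    ∃ y : KIx d → (β →₀ PolyAmbient k d), (∀ i, y i ∈ deg l) ∧ ∀ i, z i = kd (xseq k d) d y i
  div : ∀ (a b : Fin d), a ≠ b → ∀ (i l : ℕ) (y y' : β →₀ PolyAmbient k d), y ∈ deg (l + i) →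
    (X a ^ i : PolyAmbient k d) • y = (X b ^ i : PolyAmbient k d) • y' →
    ∃ u ∈ deg l, y = (X b ^ i : PolyAmbient k d) • u

section model
variable {k d n} {N : Type*} [AddCommGroup N] [Module (VeroneseRing k d n) N]
    [Module k N] {G : ℤ → Submodule k N} {q : ℕ} {β : Type*}

theorem SyzModel.monomial_smul (M : SyzModel k d n G q β) :
    ∀ (m : ℕ) (e : Fin d →₀ ℕ) (c : k) (l : ℕ) (y : β →₀ PolyAmbient k d), y ∈ M.deg l →
      Finsupp.weight (1 : Fin d → ℕ) e = m → (monomial e c : PolyAmbient k d) • y ∈ M.deg (l + m)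
  | 0, e, c, l, y, hy, he => by
    have he0 : e = 0 := by
      ext a
      have := Finsupp.le_weight (1 : Fin d → ℕ) (s := a) (by simp) e
      simp; omega
    subst he0
    have : (monomial 0 c : PolyAmbient k d) • y = c • y := by
      ext1 j
      rw [Finsupp.smul_apply, Finsupp.smul_apply, smul_eq_mul, MvPolynomial.smul_eq_C_mul]
      rfl
    rw [this]
    exact Submodule.smul_mem _ _ hy
  | m + 1, e, c, l, y, hy, he => by
    have : ∃ a, e a ≠ 0 := by
      by_contra hne
      push Not at hne
      have : e = 0 := Finsupp.ext hne
      rw [this] at he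
      simp at he
    obtain ⟨a, ha⟩ := this
    have hle : Finsupp.single a 1 ≤ e := by rw [Finsupp.single_le_iff]; omega
    obtain ⟨e', rfl⟩ := exists_add_of_le hle
    rw [map_add, wt_single] at he
    have h1 := M.monomial_smul m e' c l y hy (by omega)
    have h2 := M.step _ a _ h1
    have hx : xseq k d a = monomial (Finsupp.single a 1) (1 : k) := dif_pos a.2
    rw [hx, smul_smul, monomial_mul, one_mul] at h2
    exact h2

theorem SyzModel.smul_mem (M : SyzModel k d n G q β) (m : ℕ) (s : PolyAmbient k d)
    (hs : s ∈ SDset k d {m}) (l : ℕ) (y : β →₀ PolyAmbient k d) (hy : y ∈ M.deg l) :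
    s • y ∈ M.deg (l + m) := by
  rw [MvPolynomial.as_sum s, Finset.sum_smul]
  exact Submodule.sum_mem _ fun e he => M.monomial_smul m e _ l y hy (hs e he)

/-- The covering map of the model by the free `S`-module. -/
def SyzModel.phi (M : SyzModel k d n G q β) {γ : Type*} (bs : Module.Basis γ k (G q)) :
    (γ →₀ PolyAmbient k d) →ₗ[PolyAmbient k d] (β →₀ PolyAmbient k d) :=
  Finsupp.linearCombination (PolyAmbient k d) (fun b => M.emb (bs b : N))

theorem SyzModel.emb_zero_mem (M : SyzModel k d n G q β) (w : G q) :
    M.emb (w : N) ∈ M.deg 0 := by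
  have := M.fwd 0 (w : N) (by simp)
  simpa using this

theorem SyzModel.phi_mem (M : SyzModel k d n G q β) {γ : Type*} (bs : Module.Basis γ k (G q))
    (l : ℕ) (u : γ →₀ PolyAmbient k d) (hu : ∀ b, u b ∈ SDset k d {l}) :
    M.phi bs u ∈ M.deg l := by
  rw [SyzModel.phi, Finsupp.linearCombination_apply]
  refine Submodule.sum_mem _ fun b _ => ?_
  have := M.smul_mem l (u b) (hu b) 0 _ (M.emb_zero_mem (bs b))
  rwa [zero_add] at this

theorem const_smul_eq [IsScalarTower k (VeroneseRing k d n) N]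
    (f : N →ₗ[VeroneseRing k d n] (β →₀ PolyAmbient k d)) (c : k) (x : N) :
    f (c • x) = (C c : PolyAmbient k d) • f x := by
  have h1 : c • x = (algebraMap k (VeroneseRing k d n) c) • x := (algebraMap_smul _ c x).symm
  rw [h1, map_smul]
  rfl

theorem SyzModel.gen [IsScalarTower k (VeroneseRing k d n) N]
    (M : SyzModel k d n G q β) {γ : Type*} (bs : Module.Basis γ k (G q)) :
    ∀ (l : ℕ) (u : β →₀ PolyAmbient k d), u ∈ M.deg l →
      ∃ v : γ →₀ PolyAmbient k d, (∀ b, v b ∈ SDset k d {l}) ∧ M.phi bs v = u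
  | 0, u, hu => by
    obtain ⟨x, hx, rfl⟩ := M.bwd 0 u (by simpa using hu)
    have hx' : x ∈ G q := by simpa using hx
    refine ⟨(bs.repr ⟨x, hx'⟩).mapRange C (by simp), fun b => ?_, ?_⟩
    · rw [Finsupp.mapRange_apply]
      exact monomial_mem_SDset _ _ (by simp)
    · rw [SyzModel.phi, Finsupp.linearCombination_apply, Finsupp.sum_mapRange_index (by simp)]
      have h1 := congrArg (fun w : G q => M.emb (w : N)) (bs.linearCombination_repr ⟨x, hx'⟩)
      simp only at h1
      rw [← h1, Finsupp.linearCombination_apply, Finsupp.sum, Finsupp.sum,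
        Submodule.coe_sum, map_sum]
      refine Finset.sum_congr rfl fun b _ => ?_
      rw [Submodule.coe_smul, const_smul_eq]
  | l + 1, u, hu => by
    let T : AddSubgroup (β →₀ PolyAmbient k d) :=
      { carrier := {u | ∃ v : γ →₀ PolyAmbient k d, (∀ b, v b ∈ SDset k d {l + 1}) ∧
          M.phi bs v = u}
        add_mem' := by
          rintro _ _ ⟨v, hv, rfl⟩ ⟨w, hw, rfl⟩
          exact ⟨v + w, fun b => Submodule.add_mem _ (hv b) (hw b), map_add _ _ _⟩
        zero_mem' := ⟨0, fun b => Submodule.zero_mem _, map_zero _⟩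
        neg_mem' := by
          rintro _ ⟨v, hv, rfl⟩
          exact ⟨-v, fun b => Submodule.neg_mem _ (hv b), map_neg _ _⟩ }
    obtain ⟨y, hy, hy'⟩ := M.exact l (kdelta u d)
      (fun i => kdelta_mem (M.deg (l + 1)).toAddSubgroup u hu d i)
      (fun i => kd_kdelta _ _ _ _)
    have h1 := hy' (KIx.bot d)
    rw [kdelta_bot] at h1
    have h2 : u ∈ T := by
      rw [h1]
      apply kd_mem
      intro a _ i
      obtain ⟨v, hv, hv'⟩ := M.gen bs l _ (hy i)
      refine ⟨xseq k d a • v, fun b => ?_, ?_⟩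
      · rw [Finsupp.smul_apply, smul_eq_mul]
        refine SDset_mul ?_ (xseq_mem_SDset a) (hv b)
        rintro i hi j hj
        rw [Set.mem_singleton_iff] at hi hj ⊢
        omega
      · rw [map_smul, hv']
    exact h2

end model

section build
variable {k d n}

/-- Polynomials in degrees `[l, l+n)`. -/
def baseDeg (k : Type*) [Field k] (d n : ℕ) (β : Type*) (l : ℕ) :
    Submodule k (β →₀ PolyAmbient k d) where
  carrier := {y | ∀ b, y b ∈ SDset k d (Set.Ico l (l + n))}
  add_mem' := fun ha hb b => Submodule.add_mem _ (ha b) (hb b)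
  zero_mem' := fun b => Submodule.zero_mem _
  smul_mem' := fun c y hy b => Submodule.smul_mem _ c (hy b)

theorem mem_VeroneseSDeg {c : ℕ} {x : PolyAmbient k d} :
    x ∈ VeroneseSDeg k d n c ↔ x ∈ SDset k d (Set.Ico (c * n) (c * n + n)) := by
  constructor
  · intro h e he
    obtain ⟨j, hj, hj'⟩ := h e he
    have : Finsupp.weight (1 : Fin d → ℕ) e = c * n + j := by exact_mod_cast hj'
    rw [Set.mem_Ico]
    omega
  · intro h e he
    have := h e he
    rw [Set.mem_Ico] at this
    refine ⟨Finsupp.weight (1 : Fin d → ℕ) e - c * n, by omega, ?_⟩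
    have : Finsupp.weight (1 : Fin d → ℕ) e
      = c * n + (Finsupp.weight (1 : Fin d → ℕ) e - c * n) := by omega
    exact_mod_cast this

theorem VeroneseSDeg_neg {c : ℤ} (hc : c < 0) {x : PolyAmbient k d}
    (hx : x ∈ VeroneseSDeg k d n c) : x = 0 := by
  rw [← MvPolynomial.support_eq_empty, Finset.eq_empty_iff_forall_notMem]
  intro e he
  obtain ⟨j, hj, hj'⟩ := hx e he
  nlinarith

theorem base_model {N : Type*} [AddCommGroup N] [Module (VeroneseRing k d n) N]
    [Module k N] (G : ℤ → Submodule k N)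
    (e0 : N ≃ₗ[VeroneseRing k d n] PolyAmbient k d)
    (he0 : ∀ (c : ℤ) (x : N), x ∈ G c ↔ e0 x ∈ VeroneseSDeg k d n c) (β : Type*) [Unique β] :
    Nonempty (SyzModel k d n G 0 β) := by
  refine ⟨{
    emb := (Finsupp.lsingle (default : β)).comp e0.toLinearMap
    deg := baseDeg k d n β
    inj := ?_
    fwd := ?_
    bwd := ?_
    neg := ?_
    step := ?_
    exact := ?_
    div := ?_ }⟩
  · exact (Finsupp.single_injective _).comp e0.injective
  · intro c x hx b
    rw [he0, Nat.cast_zero, zero_add, mem_VeroneseSDeg] at hx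
    rw [Unique.eq_default b]
    simpa using hx
  · intro c y hy
    refine ⟨e0.symm (y default), ?_, ?_⟩
    · rw [he0, Nat.cast_zero, zero_add, mem_VeroneseSDeg]
      simpa using hy default
    · refine Finsupp.ext fun b => ?_
      rw [Unique.eq_default b]
      simp
  · intro c x hc hx
    rw [he0] at hx
    have := VeroneseSDeg_neg (by simpa using hc) hx
    simpa using this
  · intro l a y hy b
    rw [Finsupp.smul_apply, smul_eq_mul]
    refine SDset_mul ?_ (xseq_mem_SDset a) (hy b)
    intro i hi j hj
    rw [Set.mem_singleton_iff] at hi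
    rw [Set.mem_Ico] at hj ⊢
    omega
  · intro l z hz hc
    refine koszul_exact_free (Set.Ico l (l + n)) z (fun i b => SDset_mono ?_ (hz i b)) hc
    intro m hm
    rw [Set.mem_Ico] at hm
    exact ⟨m - 1, by rw [Set.mem_Ico]; omega, by simp; omega⟩
  · intro a b hab i l y y' hy h
    refine ⟨_, ?_, (dvd_of_eq_free hab i y y' h).symm⟩
    intro j
    rw [Finsupp.mapRange_apply]
    refine div_mem_SDset b i _ (hy j) ?_
    intro m hm
    rw [Set.mem_Ico] at hm ⊢
    omega

set_option synthInstance.maxHeartbeats 1000000 in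
set_option maxHeartbeats 2000000 in
theorem tensorGrade_iff {N : Type*} [AddCommGroup N] [Module (VeroneseRing k d n) N]
    [Module k N] [IsScalarTower k (VeroneseRing k d n) N] (W : Submodule k N) (q m : ℕ)
    {γ : Type*} (bs : Module.Basis γ k W) (z : (VeroneseRing k d n) ⊗[k] ↥W) :
    z ∈ tensorGrade k d n W q (q + m) ↔
      ∀ b, (((Algebra.TensorProduct.basis (VeroneseRing k d n) bs).repr z b :
        VeroneseRing k d n) : PolyAmbient k d) ∈ SDset k d {m * n} := by
  rw [tensorGrade, if_pos (by omega)]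
  have hm : ((q : ℤ) + m - q).toNat = m := by simp
  rw [hm]
  constructor
  · intro hz
    induction hz using Submodule.span_induction with
    | mem x hx =>
      obtain ⟨r, w, hr, rfl⟩ := hx
      intro b
      rw [Algebra.TensorProduct.basis_repr_tmul]
      rw [Finsupp.smul_apply, Finsupp.mapRange_apply, smul_eq_mul, Subalgebra.coe_mul]
      rw [mul_comm (r : PolyAmbient k d)]
      have h2 : ((algebraMap k (VeroneseRing k d n) (bs.repr w b) : VeroneseRing k d n) :
        PolyAmbient k d) = C (bs.repr w b) := rfl
      rw [h2, ← MvPolynomial.smul_eq_C_mul]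
      exact Submodule.smul_mem _ _ (mem_PolyGrade.mp hr)
    | zero => intro b; simp
    | add x y _ _ hx hy =>
      intro b
      rw [map_add, Finsupp.add_apply, Subalgebra.coe_add]
      exact Submodule.add_mem _ (hx b) (hy b)
    | smul c x _ hx =>
      intro b
      have h1 : c • x = (algebraMap k (VeroneseRing k d n) c) • x := (algebraMap_smul _ c x).symm
      rw [h1, map_smul, Finsupp.smul_apply, smul_eq_mul, Subalgebra.coe_mul]
      have h2 : ((algebraMap k (VeroneseRing k d n) c : VeroneseRing k d n) :
        PolyAmbient k d) = C c := rfl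
      rw [h2, ← MvPolynomial.smul_eq_C_mul]
      exact Submodule.smul_mem _ _ (hx b)
  · intro h
    rw [← (Algebra.TensorProduct.basis (VeroneseRing k d n) bs).linearCombination_repr z,
      Finsupp.linearCombination_apply]
    refine Submodule.sum_mem _ fun b _ => Submodule.subset_span ?_
    refine ⟨_, bs b, mem_PolyGrade.mpr (h b), ?_⟩
    simp only [Algebra.TensorProduct.basis_apply, TensorProduct.smul_tmul', smul_eq_mul, mul_one]

set_option synthInstance.maxHeartbeats 1000000 in
set_option maxHeartbeats 2000000 in
theorem tensorGrade_low {N : Type*} [AddCommGroup N] [Module (VeroneseRing k d n) N]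
    [Module k N] [IsScalarTower k (VeroneseRing k d n) N] (W : Submodule k N) (q : ℕ) (c : ℤ)
    (hc : c < q + 1) (z : (VeroneseRing k d n) ⊗[k] ↥W) (hz : z ∈ tensorGrade k d n W q c)
    (hz0 : epsilonMap k d n W z = 0) : z = 0 := by
  by_cases h : (q : ℤ) ≤ c
  · have hcq : c = q := by omega
    subst hcq
    have key : ∃ w : W, z = (1 : VeroneseRing k d n) ⊗ₜ[k] w := by
      clear hz0
      rw [tensorGrade, if_pos le_rfl] at hz
      induction hz using Submodule.span_induction with
      | mem x hx =>
        obtain ⟨r, w, hr, rfl⟩ := hx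
        rw [mem_PolyGrade, sub_self, Int.toNat_zero, zero_mul] at hr
        have hr' : r = algebraMap k (VeroneseRing k d n) (coeff 0 (r : PolyAmbient k d)) := by
          apply Subtype.ext
          change (r : PolyAmbient k d) = C (coeff 0 (r : PolyAmbient k d))
          ext e
          rw [coeff_C]
          split_ifs with he
          · rw [he]
          · by_contra hne
            apply he
            have := mem_SDset.mp hr e hne
            ext a
            have h2 := Finsupp.le_weight (1 : Fin d → ℕ) (s := a) (by simp) e
            rw [Set.mem_singleton_iff] at this
            rw [Finsupp.zero_apply]
            omega
        refine ⟨coeff 0 (r : PolyAmbient k d) • w, ?_⟩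
        rw [TensorProduct.tmul_smul, TensorProduct.smul_tmul']
        congr 1
        rw [Algebra.smul_def, mul_one]
        exact hr'
      | zero => exact ⟨0, by simp⟩
      | add x y _ _ hx hy =>
        obtain ⟨w, rfl⟩ := hx
        obtain ⟨w', rfl⟩ := hy
        exact ⟨w + w', (TensorProduct.tmul_add _ _ _).symm⟩
      | smul c x _ hx =>
        obtain ⟨w, rfl⟩ := hx
        exact ⟨c • w, (TensorProduct.tmul_smul _ _ _).symm⟩
    obtain ⟨w, rfl⟩ := key
    rw [epsilonMap, LinearMap.liftBaseChange_tmul, one_smul] at hz0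
    have : w = 0 := Subtype.ext hz0
    rw [this, TensorProduct.tmul_zero]
  · rw [tensorGrade, if_neg h] at hz
    simpa using hz

end build

section build2
variable {k d n}

/-- The graded pieces of the kernel of the covering map. -/
def kerDeg {β γ : Type*} (n : ℕ)
    (φ : (γ →₀ PolyAmbient k d) →ₗ[PolyAmbient k d] (β →₀ PolyAmbient k d)) (l : ℕ) :
    Submodule k (γ →₀ PolyAmbient k d) where
  carrier := {y | φ y = 0 ∧ ∀ b, y b ∈ SDset k d {l + n}}
  add_mem' := fun ha hb => ⟨by rw [map_add, ha.1, hb.1, add_zero],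
    fun b => Submodule.add_mem _ (ha.2 b) (hb.2 b)⟩
  zero_mem' := ⟨map_zero _, fun _ => Submodule.zero_mem _⟩
  smul_mem' := fun c y hy => by
    refine ⟨?_, fun b => Submodule.smul_mem _ c (hy.2 b)⟩
    have : c • y = (C c : PolyAmbient k d) • y := by
      ext1 j
      rw [Finsupp.smul_apply, Finsupp.smul_apply, smul_eq_mul, MvPolynomial.smul_eq_C_mul]
    rw [this, map_smul, hy.1, smul_zero]

/-- The embedding `R ⊗ W → S^(γ)`. -/
def jmap {N : Type*} [AddCommGroup N]
    [Module k N] (W : Submodule k N)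
    {γ : Type*} (bs : Module.Basis γ k W) :
    ((VeroneseRing k d n) ⊗[k] ↥W) →ₗ[VeroneseRing k d n] (γ →₀ PolyAmbient k d) :=
  (Finsupp.mapRange.linearMap (Algebra.linearMap (VeroneseRing k d n) (PolyAmbient k d))).comp
    (Algebra.TensorProduct.basis (VeroneseRing k d n) bs).repr.toLinearMap

theorem jmap_apply {N : Type*} [AddCommGroup N]
    [Module k N] (W : Submodule k N)
    {γ : Type*} (bs : Module.Basis γ k W) (z : (VeroneseRing k d n) ⊗[k] ↥W) (b : γ) :
    jmap W bs z b = (((Algebra.TensorProduct.basis (VeroneseRing k d n) bs).repr z b :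
        VeroneseRing k d n) : PolyAmbient k d) := rfl

theorem jmap_injective {N : Type*} [AddCommGroup N]
    [Module k N] (W : Submodule k N)
    {γ : Type*} (bs : Module.Basis γ k W) :
    Function.Injective (jmap (d := d) (n := n) W bs) := by
  intro z z' h
  apply (Algebra.TensorProduct.basis (VeroneseRing k d n) bs).repr.injective
  ext1 b
  apply Subtype.ext
  rw [← jmap_apply, ← jmap_apply, h]

set_option synthInstance.maxHeartbeats 1000000 in
set_option maxHeartbeats 2000000 in
theorem phi_jmap {N : Type*} [AddCommGroup N] [Module (VeroneseRing k d n) N]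
    [Module k N] [IsScalarTower k (VeroneseRing k d n) N] {G : ℤ → Submodule k N} {q : ℕ}
    {β γ : Type*} (M : SyzModel k d n G q β) (bs : Module.Basis γ k (G q))
    (z : (VeroneseRing k d n) ⊗[k] ↥(G q)) :
    M.phi bs (jmap (G q) bs z) = M.emb (epsilonMap k d n (G q) z) := by
  have : ((M.phi bs).restrictScalars (VeroneseRing k d n)).comp (jmap (G q) bs)
      = M.emb.comp (epsilonMap k d n (G q)) := by
    apply (Algebra.TensorProduct.basis (VeroneseRing k d n) bs).ext
    intro b
    have h1 : jmap (n := n) (G q) bs (Algebra.TensorProduct.basis (VeroneseRing k d n) bs b)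
        = Finsupp.single b 1 := by
      rw [jmap, LinearMap.comp_apply, LinearEquiv.coe_coe, Module.Basis.repr_self]
      rw [Finsupp.mapRange.linearMap_apply, Finsupp.mapRange_single]
      simp
    rw [LinearMap.comp_apply, LinearMap.comp_apply, h1, LinearMap.restrictScalars_apply,
      SyzModel.phi, Finsupp.linearCombination_single, one_smul,
      Algebra.TensorProduct.basis_apply, epsilonMap, LinearMap.liftBaseChange_tmul, one_smul]
    rfl
  exact LinearMap.congr_fun this z

set_option synthInstance.maxHeartbeats 1000000 in
set_option maxHeartbeats 2000000 in
/-- The embedding of the next syzygy module. -/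
def embS {N N' : Type*} [AddCommGroup N] [Module k N] {W : Submodule k N}
    [AddCommGroup N'] [Module (VeroneseRing k d n) N']
    {Z : Submodule (VeroneseRing k d n) ((VeroneseRing k d n) ⊗[k] ↥W)}
    (ψ : N' ≃ₗ[VeroneseRing k d n] ↥Z) {γ : Type*} (bs : Module.Basis γ k W) :
    N' →ₗ[VeroneseRing k d n] (γ →₀ PolyAmbient k d) :=
  (jmap W bs).comp (Z.subtype.comp ψ.toLinearMap)

set_option synthInstance.maxHeartbeats 1000000 in
set_option maxHeartbeats 2000000 in
theorem embS_apply {N N' : Type*} [AddCommGroup N] [Module k N] {W : Submodule k N}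
    [AddCommGroup N'] [Module (VeroneseRing k d n) N']
    {Z : Submodule (VeroneseRing k d n) ((VeroneseRing k d n) ⊗[k] ↥W)}
    (ψ : N' ≃ₗ[VeroneseRing k d n] ↥Z) {γ : Type*} (bs : Module.Basis γ k W) (x : N') :
    embS ψ bs x = jmap W bs (ψ x : (VeroneseRing k d n) ⊗[k] ↥W) := rfl

set_option synthInstance.maxHeartbeats 1000000 in
set_option maxHeartbeats 2000000 in
theorem embS_injective {N N' : Type*} [AddCommGroup N] [Module k N] {W : Submodule k N}
    [AddCommGroup N'] [Module (VeroneseRing k d n) N']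
    {Z : Submodule (VeroneseRing k d n) ((VeroneseRing k d n) ⊗[k] ↥W)}
    (ψ : N' ≃ₗ[VeroneseRing k d n] ↥Z) {γ : Type*} (bs : Module.Basis γ k W) :
    Function.Injective (embS ψ bs) := by
  intro x y h
  rw [embS_apply, embS_apply] at h
  exact ψ.injective (Subtype.ext (jmap_injective _ bs h))

set_option synthInstance.maxHeartbeats 1000000 in
set_option maxHeartbeats 2000000 in
theorem succ_model (hn : 2 ≤ n) {N N' : Type*} [AddCommGroup N] [Module (VeroneseRing k d n) N]
    [Module k N] [IsScalarTower k (VeroneseRing k d n) N]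
    [AddCommGroup N'] [Module (VeroneseRing k d n) N'] [Module k N']
    (G : ℤ → Submodule k N) (G' : ℤ → Submodule k N') (q : ℕ)
    (ψ : N' ≃ₗ[VeroneseRing k d n] ↥(LinearMap.ker (epsilonMap k d n (G (q : ℤ)))))
    (hψ : ∀ (c : ℤ) (x : N'), x ∈ G' c ↔
        ((ψ x : (VeroneseRing k d n) ⊗[k] ↥(G (q : ℤ))) ∈ tensorGrade k d n (G (q : ℤ)) q c))
    {β γ : Type*} (M : SyzModel k d n G q β) (bs : Module.Basis γ k (G q)) :
    Nonempty (SyzModel k d n G' (q + 1) γ) := by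
  have hcast : ∀ c : ℕ, ((q + 1 : ℕ) : ℤ) + c = q + ((c + 1 : ℕ) : ℤ) := by
    intro c; push_cast; ring
  refine ⟨{
    emb := embS ψ bs
    deg := kerDeg n (M.phi bs)
    inj := ?_
    fwd := ?_
    bwd := ?_
    neg := ?_
    step := ?_
    exact := ?_
    div := ?_ }⟩
  · exact embS_injective ψ bs
  · intro c x hx
    rw [hψ, hcast, tensorGrade_iff _ _ _ bs] at hx
    refine ⟨?_, fun b => ?_⟩
    · rw [embS_apply, phi_jmap, LinearMap.mem_ker.mp (ψ x).2, map_zero]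
    · have := hx b
      rw [embS_apply, jmap_apply]
      rwa [add_mul, one_mul] at this
  · intro c y hy
    have hyR : ∀ b, y b ∈ VeroneseRing k d n := by
      intro b e he
      have := hy.2 b e he
      exact ⟨c + 1, by rw [Set.mem_singleton_iff.mp this]; ring⟩
    let y' : γ →₀ VeroneseRing k d n := Finsupp.onFinset y.support (fun b => ⟨y b, hyR b⟩) (by
      intro b hb
      rw [Finsupp.mem_support_iff]
      intro h
      exact hb (Subtype.ext h))
    let z := (Algebra.TensorProduct.basis (VeroneseRing k d n) bs).repr.symm y'
    have hz : ∀ b, (Algebra.TensorProduct.basis (VeroneseRing k d n) bs).repr z b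
        = ⟨y b, hyR b⟩ := by
      intro b
      rw [LinearEquiv.apply_symm_apply]
      rfl
    have hjz : jmap (G q) bs z = y := by
      ext1 b
      rw [jmap_apply, hz b]
    have hz0 : epsilonMap k d n (G q) z = 0 := by
      apply M.inj
      rw [← phi_jmap M bs, hjz, hy.1, map_zero]
    refine ⟨ψ.symm ⟨z, hz0⟩, ?_, ?_⟩
    · rw [hψ, LinearEquiv.apply_symm_apply, hcast, tensorGrade_iff _ _ _ bs]
      intro b
      rw [hz b, add_mul, one_mul]
      exact hy.2 b
    · rw [embS_apply, LinearEquiv.apply_symm_apply]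
      exact hjz
  · intro c x hc hx
    rw [hψ] at hx
    have h0 := tensorGrade_low _ q c (by simpa using hc) _ hx (LinearMap.mem_ker.mp (ψ x).2)
    apply ψ.injective
    rw [map_zero]
    exact Subtype.ext h0
  · intro l a y hy
    refine ⟨by rw [map_smul, hy.1, smul_zero], fun b => ?_⟩
    rw [Finsupp.smul_apply, smul_eq_mul]
    refine SDset_mul ?_ (xseq_mem_SDset a) (hy.2 b)
    intro i hi j hj
    rw [Set.mem_singleton_iff] at hi hj ⊢
    omega
  · intro l z hz hc
    obtain ⟨y, hy, hyz⟩ := koszul_exact_free {l + n} z (fun i b => SDset_mono (by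
      intro m hm
      rw [Set.mem_singleton_iff] at hm
      exact ⟨l + n, rfl, by simp; omega⟩) ((hz i).2 b)) hc
    obtain ⟨n', rfl⟩ : ∃ n', n = n' + 1 := ⟨n - 1, by omega⟩
    obtain ⟨w, hw, hwy⟩ := M.exact (l + n') (fun i => M.phi bs (y i))
      (fun i => M.phi_mem bs (l + (n' + 1)) (y i) (hy i)) (fun i => by
        rw [kd_map, ← hyz i, (hz i).1])
    choose v hv hvw using fun i => M.gen bs _ _ (hw i)
    have hvd : ∀ i b, kd (xseq k d) d v i b ∈ SDset k d {l + (n' + 1)} := by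
      intro i b
      let T : AddSubgroup (γ →₀ PolyAmbient k d) :=
        { carrier := {y | ∀ b, y b ∈ SDset k d {l + (n' + 1)}}
          add_mem' := fun ha hb b => Submodule.add_mem _ (ha b) (hb b)
          zero_mem' := fun b => Submodule.zero_mem _
          neg_mem' := fun ha b => Submodule.neg_mem _ (ha b) }
      refine kd_mem (xseq k d) T d v ?_ i b
      intro a _ i b
      rw [Finsupp.smul_apply, smul_eq_mul]
      refine SDset_mul ?_ (xseq_mem_SDset a) (hv i b)
      intro i hi j hj
      rw [Set.mem_singleton_iff] at hi hj ⊢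
      omega
    refine ⟨fun i => y i - kd (xseq k d) d v i, fun i => ⟨?_, fun b => ?_⟩, fun i => ?_⟩
    · rw [map_sub, ← kd_map, hwy i, sub_eq_zero]
      congr 1
      funext j
      exact (hvw j).symm
    · exact Submodule.sub_mem _ (hy i b) (hvd i b)
    · rw [kd_sub, kd_kd, sub_zero]
      exact hyz i
  · intro a b hab i l y y' hy h
    have h1 := dvd_of_eq_free hab i y y' h
    refine ⟨_, ⟨?_, ?_⟩, h1.symm⟩
    · have h2 := hy.1
      rw [← h1, map_smul] at h2
      ext1 j
      have h3 := DFunLike.congr_fun h2 j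
      rw [Finsupp.smul_apply, smul_eq_mul, Finsupp.zero_apply, mul_eq_zero] at h3
      exact h3.resolve_left (pow_ne_zero _ (X_ne_zero b))
    · intro j
      rw [Finsupp.mapRange_apply]
      refine div_mem_SDset b i _ (hy.2 j) ?_
      intro m hm
      rw [Set.mem_singleton_iff] at hm ⊢
      omega

end build2

section final
variable {k d n}

theorem smul_cancel {β : Type*} {s : PolyAmbient k d} (hs : s ≠ 0) {y y' : β →₀ PolyAmbient k d}
    (h : s • y = s • y') : y = y' := by
  ext1 j
  have := DFunLike.congr_fun h j
  rw [Finsupp.smul_apply, Finsupp.smul_apply, smul_eq_mul, smul_eq_mul] at this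
  exact mul_left_cancel₀ hs this

theorem mem_R_of {D : Set ℕ} (hD : ∀ m ∈ D, n ∣ m) {s : PolyAmbient k d} (hs : s ∈ SDset k d D) :
    s ∈ VeroneseRing k d n := by
  intro e he
  obtain ⟨c, hc⟩ := hD _ (hs e he)
  exact ⟨c, by rw [hc, mul_comm]⟩

theorem comm_lemma (hn : 2 ≤ n) {β : Type*}
    (g : PolyAmbient k d →ₗ[VeroneseRing k d n] (β →₀ PolyAmbient k d)) (a : Fin d) (i : ℕ)
    (s : PolyAmbient k d) (hs : s ∈ SDset k d {m | m % n = i}) :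
    (X a ^ i : PolyAmbient k d) • g s = s • g (X a ^ i) := by
  have h1 : (X a ^ i : PolyAmbient k d) ^ n ∈ VeroneseRing k d n := by
    rw [← pow_mul]
    refine mem_R_of ?_ (Xpow_mem_SDset a (i * n))
    rintro m rfl
    exact Dvd.intro_left i rfl
  have h2 : (X a ^ i : PolyAmbient k d) ^ (n - 1) * s ∈ VeroneseRing k d n := by
    rw [← pow_mul]
    refine mem_R_of (D := {m | n ∣ m}) (fun _ h => h)
      (SDset_mul ?_ (Xpow_mem_SDset a (i * (n - 1))) hs)
    intro p hp q hq
    rw [Set.mem_singleton_iff] at hp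
    rw [Set.mem_setOf_eq] at hq ⊢
    obtain ⟨n', rfl⟩ : ∃ n', n = n' + 1 := ⟨n - 1, by omega⟩
    have h3 := Nat.div_add_mod q (n' + 1)
    rw [hq] at h3
    rw [hp, ← h3]
    refine ⟨i + q / (n' + 1), ?_⟩
    simp
    ring
  have h3 : (⟨_, h1⟩ : VeroneseRing k d n) • s = (⟨_, h2⟩ : VeroneseRing k d n) • (X a ^ i) := by
    change (X a ^ i : PolyAmbient k d) ^ n * s = ((X a ^ i : PolyAmbient k d) ^ (n - 1) * s) * _
    obtain ⟨n', rfl⟩ : ∃ n', n = n' + 1 := ⟨n - 1, by omega⟩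
    simp only [Nat.add_sub_cancel]
    ring
  have h4 := congrArg g h3
  rw [map_smul, map_smul] at h4
  change ((X a ^ i : PolyAmbient k d) ^ n) • g s
    = ((X a ^ i : PolyAmbient k d) ^ (n - 1) * s) • g (X a ^ i) at h4
  refine smul_cancel (s := (X a ^ i : PolyAmbient k d) ^ (n - 1))
    (pow_ne_zero _ (pow_ne_zero _ (X_ne_zero a))) ?_
  rw [smul_smul, smul_smul, ← h4, ← pow_succ]
  congr 2
  omega

/-- Projection of `S` to the part of degrees divisible by `n`, `k`-linear version. -/
def rho0 (k : Type*) [Field k] (d n : ℕ) : PolyAmbient k d →ₗ[k] PolyAmbient k d :=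
  (basisMonomials (Fin d) k).constr k (fun e =>
    if n ∣ Finsupp.weight (1 : Fin d → ℕ) e then monomial e 1 else 0)

theorem rho0_monomial (e : Fin d →₀ ℕ) (c : k) : rho0 k d n (monomial e c) =
    if n ∣ Finsupp.weight (1 : Fin d → ℕ) e then monomial e c else 0 := by
  have h1 : (monomial e c : PolyAmbient k d) = c • basisMonomials (Fin d) k e := by
    rw [coe_basisMonomials, smul_monomial, smul_eq_mul, mul_one]
  rw [h1, map_smul, rho0, Module.Basis.constr_basis]
  split_ifs
  · rw [coe_basisMonomials]
  · rw [smul_zero]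

theorem rho0_of_mem (s : PolyAmbient k d) (hs : s ∈ SDset k d {m | n ∣ m}) :
    rho0 k d n s = s := by
  conv_lhs => rw [MvPolynomial.as_sum s]
  conv_rhs => rw [MvPolynomial.as_sum s]
  rw [map_sum]
  refine Finset.sum_congr rfl fun e he => ?_
  rw [rho0_monomial, if_pos (show n ∣ Finsupp.weight (1 : Fin d → ℕ) e from hs e he)]

theorem rho0_of_not_mem (s : PolyAmbient k d) (hs : s ∈ SDset k d {m | ¬ n ∣ m}) :
    rho0 k d n s = 0 := by
  rw [MvPolynomial.as_sum s, map_sum]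
  refine Finset.sum_eq_zero fun e he => ?_
  rw [rho0_monomial, if_neg (hs e he)]

theorem rho0_mem (s : PolyAmbient k d) : rho0 k d n s ∈ VeroneseRing k d n := by
  rw [MvPolynomial.as_sum s, map_sum]
  refine Subalgebra.sum_mem _ fun e _ => ?_
  rw [rho0_monomial]
  split_ifs with h
  · exact mem_R_of (D := {m | n ∣ m}) (fun _ h => h) (monomial_mem_SDset e _ h)
  · exact Subalgebra.zero_mem _

theorem rho0_smul (r s : PolyAmbient k d) (hr : r ∈ VeroneseRing k d n) :
    rho0 k d n (r * s) = r * rho0 k d n s := by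
  rw [MvPolynomial.as_sum r, MvPolynomial.as_sum s]
  simp only [map_sum, Finset.sum_mul, Finset.mul_sum]
  refine Finset.sum_congr rfl fun e he => Finset.sum_congr rfl fun e' he' => ?_
  have hd : n ∣ Finsupp.weight (1 : Fin d → ℕ) e' := by
    obtain ⟨c, hc⟩ := hr e' he'
    rw [hc]; exact Dvd.intro_left c rfl
  rw [monomial_mul, rho0_monomial, rho0_monomial, map_add]
  by_cases h : n ∣ Finsupp.weight (1 : Fin d → ℕ) e
  · rw [if_pos h, if_pos ((Nat.dvd_add_right hd).mpr h), monomial_mul]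
  · rw [if_neg h, if_neg (fun h' => h ((Nat.dvd_add_right hd).mp h')), mul_zero]

/-- Projection `S → R`, multiplied by a fixed polynomial. -/
def rhoMul (k : Type*) [Field k] (d n : ℕ) (v : PolyAmbient k d) :
    PolyAmbient k d →ₗ[VeroneseRing k d n] VeroneseRing k d n where
  toFun s := ⟨rho0 k d n (s * v), rho0_mem _⟩
  map_add' s t := Subtype.ext (by
    change rho0 k d n ((s + t) * v) = rho0 k d n (s * v) + rho0 k d n (t * v)
    rw [add_mul, map_add])
  map_smul' r s := Subtype.ext (by
    change rho0 k d n (((r : PolyAmbient k d) * s) * v) = (r : PolyAmbient k d) * rho0 k d n (s * v)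
    rw [mul_assoc, rho0_smul _ _ r.2])

theorem final_neg (hn : 2 ≤ n) (a0 : Fin d) {N : Type*} [AddCommGroup N]
    [Module (VeroneseRing k d n) N] [Module k N] {G : ℤ → Submodule k N} {q : ℕ} {β : Type*}
    (M : SyzModel k d n G q β) (t : ℤ) (ht : t < q)
    (f : PolyAmbient k d →ₗ[VeroneseRing k d n] N)
    (hf : ∀ (c : ℤ) (x : PolyAmbient k d), x ∈ VeroneseSDeg k d n c → f x ∈ G (c + t)) :
    f = 0 := by
  ext1 s
  rw [MvPolynomial.as_sum s, map_sum, LinearMap.zero_apply]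
  refine Finset.sum_eq_zero fun e _ => ?_
  have hi := Nat.mod_lt (Finsupp.weight (1 : Fin d → ℕ) e) (show 0 < n by omega)
  set i := Finsupp.weight (1 : Fin d → ℕ) e % n with hidef
  have h1 := comm_lemma hn (M.emb.comp f) a0 i (monomial e (coeff e s))
    (monomial_mem_SDset e _ hidef.symm)
  have h2 : f (X a0 ^ i) = 0 := by
    apply M.neg t _ ht
    have := hf ((0 : ℕ) : ℤ) (X a0 ^ i) (mem_VeroneseSDeg.mpr (SDset_mono (by
      rintro m rfl
      rw [Set.mem_Ico]; omega) (Xpow_mem_SDset a0 i)))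
    simpa using this
  rw [LinearMap.comp_apply, LinearMap.comp_apply, h2, map_zero, smul_zero,
    ← smul_zero (X a0 ^ i : PolyAmbient k d)] at h1
  have h3 := smul_cancel (pow_ne_zero _ (X_ne_zero a0)) h1
  apply M.inj
  rw [h3, map_zero]

theorem final_pos (hn : 2 ≤ n) (a0 a1 : Fin d) (hab : a0 ≠ a1) {N : Type*} [AddCommGroup N]
    [Module (VeroneseRing k d n) N] [Module k N] [IsScalarTower k (VeroneseRing k d n) N]
    {G : ℤ → Submodule k N} {q : ℕ} {β : Type*}
    (M : SyzModel k d n G q β) (c : ℕ) (hc : 1 ≤ c)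
    (f : PolyAmbient k d →ₗ[VeroneseRing k d n] N)
    (hf : ∀ x : PolyAmbient k d, x ∈ VeroneseSDeg k d n (0 : ℕ) → f x ∈ G (q + c)) :
    ∃ (m : ℕ) (g : PolyAmbient k d →ₗ[VeroneseRing k d n] (Fin m → VeroneseRing k d n))
      (h : (Fin m → VeroneseRing k d n) →ₗ[VeroneseRing k d n] N),
      f = h.comp g := by
  classical
  let bs := Module.Basis.ofVectorSpace k (G q)
  have hin : ∀ i, i < n → i ≤ c * n := fun i hi => by nlinarith
  have key : ∀ i : Fin n, ∃ v : Module.Basis.ofVectorSpaceIndex k (G q) →₀ PolyAmbient k d,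
      (∀ b, v b ∈ SDset k d {c * n - i}) ∧
      ∀ s ∈ SDset k d {m | m % n = i}, M.emb (f s) = s • M.phi bs v := by
    intro i
    have h0 := comm_lemma hn (M.emb.comp f) a0 i (X a1 ^ (i : ℕ)) (SDset_mono (by
      rintro m rfl; exact Nat.mod_eq_of_lt i.2) (Xpow_mem_SDset a1 (i : ℕ)))
    have h1 : M.emb (f (X a1 ^ (i : ℕ))) ∈ M.deg (c * n) := M.fwd c _ (hf _
      (mem_VeroneseSDeg.mpr (SDset_mono (by
        rintro m rfl
        rw [Set.mem_Ico]; omega) (Xpow_mem_SDset a1 (i : ℕ)))))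
    obtain ⟨u, hu, hu'⟩ := M.div a0 a1 hab i (c * n - i) _ _
      (by rwa [Nat.sub_add_cancel (hin i i.2)]) h0
    obtain ⟨v, hv, rfl⟩ := M.gen bs _ u hu
    refine ⟨v, hv, fun s hs => ?_⟩
    have h2 := comm_lemma hn (M.emb.comp f) a1 i s hs
    rw [LinearMap.comp_apply] at hu'
    rw [LinearMap.comp_apply, LinearMap.comp_apply, hu', smul_comm] at h2
    exact smul_cancel (pow_ne_zero _ (X_ne_zero a1)) h2
  choose v hv hvs using key
  let J : Finset (Fin n × Module.Basis.ofVectorSpaceIndex k (G q)) :=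
    Finset.univ.biUnion fun i => (v i).support.image fun b => (i, b)
  let E : Fin J.card ≃ J := J.equivFin.symm
  refine ⟨J.card, LinearMap.pi (fun j => rhoMul k d n (v (E j).1.1 (E j).1.2)),
    Fintype.linearCombination (VeroneseRing k d n) (fun j => ((bs (E j).1.2 : G q) : N)), ?_⟩
  have hJ : ∀ s, f s = ∑ i, ∑ b ∈ (v i).support, rhoMul k d n (v i b) s • ((bs b : G q) : N) := by
    intro s
    rw [MvPolynomial.as_sum s]
    simp only [map_sum, Finset.sum_smul]
    have hcomm : ∀ i, ∑ b ∈ (v i).support, ∑ e ∈ s.support,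
        rhoMul k d n (v i b) (monomial e (coeff e s)) • ((bs b : G q) : N)
        = ∑ e ∈ s.support, ∑ b ∈ (v i).support,
        rhoMul k d n (v i b) (monomial e (coeff e s)) • ((bs b : G q) : N) :=
      fun i => Finset.sum_comm
    simp only [hcomm]
    rw [Finset.sum_comm]
    refine Finset.sum_congr rfl fun e _ => ?_
    have hi := Nat.mod_lt (Finsupp.weight (1 : Fin d → ℕ) e) (show 0 < n by omega)
    let i : Fin n := ⟨_, hi⟩
    have hs : ∀ (i' : Fin n) b, (monomial e (coeff e s) : PolyAmbient k d) * v i' b ∈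
        SDset k d {Finsupp.weight (1 : Fin d → ℕ) e + (c * n - i')} := fun i' b =>
      SDset_mul (by rintro p rfl q rfl; rfl) (monomial_mem_SDset e _ rfl) (hv i' b)
    have hmod : ∀ i' : Fin n, n ∣ Finsupp.weight (1 : Fin d → ℕ) e + (c * n - i') ↔ i = i' := by
      intro i'
      have h1 := hin i' i'.2
      have h2 := Nat.div_add_mod (Finsupp.weight (1 : Fin d → ℕ) e) n
      rw [Fin.ext_iff]
      change _ ↔ Finsupp.weight (1 : Fin d → ℕ) e % n = i'
      have h3 : Finsupp.weight (1 : Fin d → ℕ) e + (c * n - i') + i'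
        = Finsupp.weight (1 : Fin d → ℕ) e + c * n := by omega
      constructor
      · rintro ⟨m, hm⟩
        rw [hm] at h3
        have h4 := congrArg (· % n) h3
        simp only [Nat.mul_add_mod, Nat.add_mul_mod_self_right] at h4
        rw [← h4]
        exact Nat.mod_eq_of_lt i'.2
      · intro h
        rw [h] at h2
        have : Finsupp.weight (1 : Fin d → ℕ) e + (c * n - i')
          = n * (Finsupp.weight (1 : Fin d → ℕ) e / n) + n * c := by
          rw [mul_comm n c]; omega
        rw [this]
        exact Dvd.intro _ (mul_add _ _ _)
    rw [Finset.sum_eq_single i]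
    · apply M.inj
      rw [hvs i _ (monomial_mem_SDset e _ rfl), map_sum, SyzModel.phi,
        Finsupp.linearCombination_apply, Finsupp.sum, Finset.smul_sum]
      refine Finset.sum_congr rfl fun b _ => ?_
      rw [map_smul, smul_smul]
      have h5 : ((rhoMul k d n (v i b) (monomial e (coeff e s)) : VeroneseRing k d n) :
          PolyAmbient k d) = monomial e (coeff e s) * v i b := by
        refine rho0_of_mem _ (SDset_mono ?_ (hs i b))
        rintro m rfl
        exact (hmod i).mpr rfl
      rw [← h5]
      rfl
    · intro i' _ hne
      refine Finset.sum_eq_zero fun b _ => ?_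
      have h5 : rhoMul k d n (v i' b) (monomial e (coeff e s)) = 0 := by
        apply Subtype.ext
        refine rho0_of_not_mem _ (SDset_mono ?_ (hs i' b))
        rintro m rfl h
        exact hne ((hmod i').mp h).symm
      rw [h5, zero_smul]
    · intro h
      exact absurd (Finset.mem_univ _) h
  ext1 s
  rw [hJ s, LinearMap.comp_apply, Fintype.linearCombination_apply]
  simp only [LinearMap.pi_apply]
  rw [E.sum_comp (fun j : J => rhoMul k d n (v j.1.1 j.1.2) s • ((bs j.1.2 : G q) : N)),
    Finset.sum_coe_sort J (fun j => rhoMul k d n (v j.1 j.2) s • ((bs j.2 : G q) : N)),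
    Finset.sum_biUnion]
  · refine Finset.sum_congr rfl fun i _ => ?_
    rw [Finset.sum_image]
    intro b _ b' _ h
    exact (Prod.mk.inj h).2
  · intro i _ i' _ hne
    rw [Function.onFun, Finset.disjoint_left]
    rintro ⟨j, b⟩ h1 h2
    simp only [Finset.mem_image, Prod.mk.injEq] at h1 h2
    obtain ⟨_, _, h1, _⟩ := h1
    obtain ⟨_, _, h2, _⟩ := h2
    exact hne (h1.trans h2.symm)

end final

set_option synthInstance.maxHeartbeats 1000000 in
set_option maxHeartbeats 2000000 in
/--
Let `a ≥ 1`, `n ≥ 2` and `d = an`, and let `(N_p)` be the graded syzygy modules of the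
graded `R`-module `S` over the Veronese subring `R = S^{(n)}`, as in Statement 9.
Let `p ≥ 0` and `t ∈ ℤ` with `t ≠ p`.  Then every `R`-linear map `f : S → N_p` that is
homogeneous of degree `t` (i.e. `f(S'_c) ⊆ (N_p)_{c+t}` for all `c`) factors through a
finitely generated free `R`-module.  (In other words, the graded stable Hom-module
`sHom_R(S, Ω^p S)` is concentrated in degree `p`.)
-/
theorem stmt10 (a : ℕ) (ha : 1 ≤ a) (hn : 2 ≤ n) (hD : d = a * n)
    (N : ℕ → Type*) [∀ p, AddCommGroup (N p)] [∀ p, Module (VeroneseRing k d n) (N p)]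
    [∀ p, Module k (N p)] [∀ p, IsScalarTower k (VeroneseRing k d n) (N p)]
    (𝒩 : ∀ p : ℕ, ℤ → Submodule k (N p))
    (e0 : N 0 ≃ₗ[VeroneseRing k d n] PolyAmbient k d)
    (he0 : ∀ (c : ℤ) (x : N 0), x ∈ 𝒩 0 c ↔ e0 x ∈ VeroneseSDeg k d n c)
    (ψ : ∀ p : ℕ, N (p + 1) ≃ₗ[VeroneseRing k d n]
        ↥(LinearMap.ker (epsilonMap k d n (𝒩 p (p : ℤ)))))
    (hψ : ∀ (p : ℕ) (c : ℤ) (x : N (p + 1)), x ∈ 𝒩 (p + 1) c ↔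
        ((ψ p x : (VeroneseRing k d n) ⊗[k] ↥(𝒩 p (p : ℤ))) ∈
          tensorGrade k d n (𝒩 p (p : ℤ)) p c))
    (p : ℕ) (t : ℤ) (ht : t ≠ (p : ℤ))
    (f : PolyAmbient k d →ₗ[VeroneseRing k d n] N p)
    (hf : ∀ (c : ℤ) (x : PolyAmbient k d), x ∈ VeroneseSDeg k d n c → f x ∈ 𝒩 p (c + t)) :
    ∃ (m : ℕ) (g : PolyAmbient k d →ₗ[VeroneseRing k d n] (Fin m → VeroneseRing k d n))
      (h : (Fin m → VeroneseRing k d n) →ₗ[VeroneseRing k d n] N p),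
      f = h.comp g := by

  have hmodel : ∀ q : ℕ, ∃ β, Nonempty (SyzModel k d n (𝒩 q) q β) := by
    intro q
    induction q with
    | zero => exact ⟨PUnit, base_model (𝒩 0) e0 he0 PUnit⟩
    | succ q ih =>
      obtain ⟨β, ⟨M⟩⟩ := ih
      exact ⟨_, succ_model hn (𝒩 q) (𝒩 (q + 1)) q (ψ q) (hψ q) M
        (Module.Basis.ofVectorSpace k (𝒩 q (q : ℤ)))⟩
  obtain ⟨β, ⟨M⟩⟩ := hmodel p
  have hd2 : 2 ≤ d := by nlinarith
  let a0 : Fin d := ⟨0, by omega⟩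
  let a1 : Fin d := ⟨1, by omega⟩
  rcases lt_or_gt_of_ne ht with h | h
  · exact ⟨0, 0, 0, by rw [final_neg hn a0 M t h f hf, LinearMap.comp_zero]⟩
  · obtain ⟨c, hc⟩ := Int.eq_ofNat_of_zero_le (show 0 ≤ t - p by omega)
    refine final_pos hn a0 a1 (by simp [a0, a1]) M c (by omega) f ?_
    intro x hx
    have h1 := hf _ x hx
    have h2 : ((0 : ℕ) : ℤ) + t = p + c := by omega
    rwa [h2] at h1

end
end
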